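/- arXiv:1309.0796 — 4 statements merged into one kernel-verified Lean document; each statement's English description precedes it below -/
import Mathlib

section
/- Greedy normal form: every element g ≠ 1 of the positive braid monoid B_n^+ admits a unique decomposition g = g_1 * g_2 * ⋯ * g_p where each g_i is a left-divisor of Δ_n different from 1 and, for each i, g_i is a greatest common left-divisor of g_i * g_{i+1} * ⋯ * g_p and Δ_n. -/
/-- In a monoid, `a` left-divides `b` if `b = a * c` for some `c`. -/
def LeftDvd {M : Type*} [Monoid M] (a b : M) : Prop := ∃ c, b = a * c

/-- `d` is a greatest common left-divisor of `a` and `b`: it is a common left-divisor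
of `a` and `b` which is left-divided by every common left-divisor of `a` and `b`. -/
def IsGCLD {M : Type*} [Monoid M] (a b d : M) : Prop :=
  LeftDvd d a ∧ LeftDvd d b ∧ ∀ e, LeftDvd e a → LeftDvd e b → LeftDvd e d

/-- The braid relations on the free monoid over `Fin (n - 1)`: the index `i : Fin (n - 1)`
stands for the Artin generator `σ_{i+1}` (indices are 0-based), and the relations are
`σ_i σ_j σ_i = σ_j σ_i σ_j` for `|i - j| = 1` and `σ_i σ_j = σ_j σ_i` for `|i - j| ≥ 2`. -/
def braidRels (n : ℕ) : FreeMonoid (Fin (n - 1)) → FreeMonoid (Fin (n - 1)) → Prop :=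
  fun x y =>
    (∃ i j : Fin (n - 1), (i : ℕ) + 1 = (j : ℕ) ∧
        x = .of i * .of j * .of i ∧ y = .of j * .of i * .of j) ∨
    (∃ i j : Fin (n - 1), (i : ℕ) + 2 ≤ (j : ℕ) ∧
        x = .of i * .of j ∧ y = .of j * .of i)

/-- The positive braid monoid `B_n⁺`, presented by the generators `σ_1, …, σ_{n-1}`
and the braid relations. -/
def BraidMonoid (n : ℕ) := PresentedMonoid (braidRels n)

instance (n : ℕ) : Monoid (BraidMonoid n) :=
  inferInstanceAs (Monoid (PresentedMonoid (braidRels n)))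

/-- The generator `σ_{i+1}` of `B_n⁺` (0-based index `i : Fin (n - 1)`). -/
def σ {n : ℕ} (i : Fin (n - 1)) : BraidMonoid n := PresentedMonoid.of (braidRels n) i

/-- `desc n k = σ_k σ_{k-1} ⋯ σ_1` (1-based indices; `desc n 0 = 1`). -/
def desc (n : ℕ) : ℕ → BraidMonoid n
  | 0 => 1
  | k + 1 => (if h : k < n - 1 then σ ⟨k, h⟩ else 1) * desc n k

/-- `deltaAux n m` is Garside's fundamental element `Δ_m` computed inside `B_n⁺`:
`Δ_1 = 1` and `Δ_{m+1} = Δ_m ⬝ (σ_m σ_{m-1} ⋯ σ_1)`. -/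
def deltaAux (n : ℕ) : ℕ → BraidMonoid n
  | 0 => 1
  | m + 1 => deltaAux n m * desc n m

/-- Garside's fundamental element `Δ_n` of the positive braid monoid `B_n⁺`. -/
def Δ (n : ℕ) : BraidMonoid n := deltaAux n n

namespace BraidMonoid

variable {n : ℕ}

/-- The canonical surjection from words in the Artin generators to the positive braid monoid. -/
def mk (n : ℕ) : FreeMonoid (Fin (n - 1)) →* BraidMonoid n := PresentedMonoid.mk (braidRels n)

theorem mk_of (i : Fin (n - 1)) : mk n (.of i) = σ i := rfl

theorem mk_surjective (x : BraidMonoid n) : ∃ u, mk n u = x :=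
  PresentedMonoid.surjective_mk x

theorem mk_eq_mk_iff {u v : FreeMonoid (Fin (n - 1))} :
    mk n u = mk n v ↔ ConGen.Rel (braidRels n) u v :=
  PresentedMonoid.mk_eq_mk_iff

/-- The word length, as a homomorphism to the additive natural numbers. -/
def lenHom (n : ℕ) : BraidMonoid n →* Multiplicative ℕ :=
  PresentedMonoid.lift (rels := braidRels n) (fun _ => Multiplicative.ofAdd 1) (by
    rintro a b (⟨i, j, -, rfl, rfl⟩ | ⟨i, j, -, rfl, rfl⟩) <;> simp)

/-- The length of a positive braid. -/
def len (x : BraidMonoid n) : ℕ := (lenHom n x).toAdd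

@[simp] theorem len_one : len (1 : BraidMonoid n) = 0 := by simp [len]

@[simp] theorem len_mul (x y : BraidMonoid n) : len (x * y) = len x + len y := by simp [len]

@[simp] theorem len_σ (i : Fin (n - 1)) : len (σ i) = 1 := rfl

theorem len_mk (u : FreeMonoid (Fin (n - 1))) : len (mk n u) = u.length := by
  induction u with
  | one => simp
  | of i => simp [mk_of]
  | mul u v hu hv => simp [hu, hv]

theorem eq_σ_mul {x : BraidMonoid n} (hx : x ≠ 1) : ∃ i y, x = σ i * y := by
  obtain ⟨u, rfl⟩ := mk_surjective x
  cases u with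
  | one => simp at hx
  | of_mul i u => exact ⟨i, mk n u, by simp [mk_of]⟩

theorem len_eq_zero {x : BraidMonoid n} : len x = 0 ↔ x = 1 := by
  refine ⟨fun h => ?_, by rintro rfl; simp⟩
  by_contra hx
  obtain ⟨i, y, rfl⟩ := eq_σ_mul hx
  simp at h

/-- Neighbouring generator indices. -/
def Adj (i j : Fin (n - 1)) : Prop := (i : ℕ) + 1 = j ∨ (j : ℕ) + 1 = i

/-- Generator indices at distance at least two. -/
def Far (i j : Fin (n - 1)) : Prop := (i : ℕ) + 2 ≤ j ∨ (j : ℕ) + 2 ≤ i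

theorem Adj.symm {i j : Fin (n - 1)} (h : Adj i j) : Adj j i := Or.symm h

theorem Far.symm {i j : Fin (n - 1)} (h : Far i j) : Far j i := Or.symm h

theorem Adj.braid {i j : Fin (n - 1)} (h : Adj i j) (z : BraidMonoid n) :
    σ i * (σ j * (σ i * z)) = σ j * (σ i * (σ j * z)) := by
  have key : ∀ i j : Fin (n - 1), (i : ℕ) + 1 = j →
      (σ i * σ j * σ i : BraidMonoid n) = σ j * σ i * σ j := fun i j h =>
    PresentedMonoid.mk_eq_mk_of_rel (rels := braidRels n) (Or.inl ⟨i, j, h, rfl, rfl⟩)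
  have : (σ i * σ j * σ i : BraidMonoid n) = σ j * σ i * σ j := by
    rcases h with h | h
    · exact key i j h
    · exact (key j i h).symm
  simpa only [mul_assoc] using congrArg (· * z) this

theorem Far.comm {i j : Fin (n - 1)} (h : Far i j) (z : BraidMonoid n) :
    σ i * (σ j * z) = σ j * (σ i * z) := by
  have key : ∀ i j : Fin (n - 1), (i : ℕ) + 2 ≤ j →
      (σ i * σ j : BraidMonoid n) = σ j * σ i := fun i j h =>
    PresentedMonoid.mk_eq_mk_of_rel (rels := braidRels n) (Or.inr ⟨i, j, h, rfl, rfl⟩)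
  have : (σ i * σ j : BraidMonoid n) = σ j * σ i := by
    rcases h with h | h
    · exact key i j h
    · exact (key j i h).symm
  simpa only [mul_assoc] using congrArg (· * z) this

/-- `Completes i x j y` says that `σ i * x` and `σ j * y` agree as a common multiple of the
least common multiple of `σ i` and `σ j`. -/
def Completes (i : Fin (n - 1)) (x : BraidMonoid n) (j : Fin (n - 1)) (y : BraidMonoid n) : Prop :=
  (i = j ∧ x = y) ∨ (Far i j ∧ ∃ z, x = σ j * z ∧ y = σ i * z) ∨
    (Adj i j ∧ ∃ z, x = σ j * (σ i * z) ∧ y = σ i * (σ j * z))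

theorem Completes.symm {i j : Fin (n - 1)} {x y : BraidMonoid n} (h : Completes i x j y) :
    Completes j y i x := by
  rcases h with ⟨rfl, rfl⟩ | ⟨h, z, rfl, rfl⟩ | ⟨h, z, rfl, rfl⟩
  · exact Or.inl ⟨rfl, rfl⟩
  · exact Or.inr (Or.inl ⟨h.symm, z, rfl, rfl⟩)
  · exact Or.inr (Or.inr ⟨h.symm, z, rfl, rfl⟩)

theorem Completes.mul_right {i j : Fin (n - 1)} {x y : BraidMonoid n} (h : Completes i x j y)
    (w : BraidMonoid n) : Completes i (x * w) j (y * w) := by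
  rcases h with ⟨rfl, rfl⟩ | ⟨h, z, rfl, rfl⟩ | ⟨h, z, rfl, rfl⟩
  · exact Or.inl ⟨rfl, rfl⟩
  · exact Or.inr (Or.inl ⟨h, z * w, by simp only [mul_assoc], by simp only [mul_assoc]⟩)
  · exact Or.inr (Or.inr ⟨h, z * w, by simp only [mul_assoc], by simp only [mul_assoc]⟩)

theorem eq_or_far_or_adj (i j : Fin (n - 1)) : i = j ∨ Far i j ∨ Adj i j := by
  unfold Far Adj
  rw [Fin.ext_iff]
  omega

theorem Far.not_adj {i j : Fin (n - 1)} (h : Far i j) : ¬ Adj i j := by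
  unfold Far Adj at *
  omega

theorem Far.ne {i j : Fin (n - 1)} (h : Far i j) : i ≠ j := by
  unfold Far at h
  rintro rfl
  omega

theorem Adj.ne {i j : Fin (n - 1)} (h : Adj i j) : i ≠ j := by
  unfold Adj at h
  rintro rfl
  omega

theorem Completes.eq {i : Fin (n - 1)} {x y : BraidMonoid n} (h : Completes i x i y) : x = y := by
  rcases h with ⟨-, h⟩ | ⟨h, -⟩ | ⟨h, -⟩
  · exact h
  · exact absurd rfl h.ne
  · exact absurd rfl h.ne

theorem Completes.of_far {i j : Fin (n - 1)} {x y : BraidMonoid n} (h : Completes i x j y)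
    (hij : Far i j) : ∃ z, x = σ j * z ∧ y = σ i * z := by
  rcases h with ⟨h, -⟩ | ⟨-, h⟩ | ⟨h, -⟩
  · exact absurd h hij.ne
  · exact h
  · exact absurd h hij.not_adj

theorem Completes.of_adj {i j : Fin (n - 1)} {x y : BraidMonoid n} (h : Completes i x j y)
    (hij : Adj i j) : ∃ z, x = σ j * (σ i * z) ∧ y = σ i * (σ j * z) := by
  rcases h with ⟨h, -⟩ | ⟨h, -⟩ | ⟨-, h⟩
  · exact absurd h hij.ne
  · exact absurd hij h.not_adj
  · exact h

/-- The cube condition for a generator adjacent to two generators that are far apart. -/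
theorem completes_of_adj_adj_far {L : ℕ}
    (H : ∀ i j (x y : BraidMonoid n), len x < L → σ i * x = σ j * y → Completes i x j y)
    {i j k : Fin (n - 1)} (hik : Adj i k) (hkj : Adj k j) (hij : Far i j) {s t : BraidMonoid n}
    (hL : len s + 2 ≤ L) (e : σ i * (σ k * s) = σ j * (σ k * t)) :
    Completes i (σ k * (σ i * s)) j (σ k * (σ j * t)) := by
  have hl := congrArg len e
  simp only [len_mul, len_σ] at hl
  obtain ⟨a, h1, h2⟩ := (H _ _ _ _ (by simp; omega) e).of_far hij
  obtain ⟨u, rfl, rfl⟩ := (H _ _ _ _ (by omega) h1).of_adj hkj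
  obtain ⟨v, rfl, h3⟩ := (H _ _ _ _ (by omega) h2).of_adj hik.symm
  simp only [len_mul, len_σ] at hL hl
  have h4 := (H _ _ _ _ (by simp; omega) h3).eq
  obtain ⟨w, rfl, rfl⟩ := (H _ _ _ _ (by omega) h4).of_far hij.symm
  refine Or.inr (Or.inl ⟨hij, σ k * (σ j * (σ i * (σ k * w))), ?_, ?_⟩)
  · rw [hij.comm, hik.braid, hkj.braid]
  · rw [hij.symm.comm (σ k * (σ j * w)), hkj.symm.braid w, hik.symm.braid (σ j * (σ k * w)),
      hij.comm]

/-- The cube condition for two generators that are far apart and both adjacent to a third one. -/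
theorem completes_of_adj_far_adj {L : ℕ}
    (H : ∀ i j (x y : BraidMonoid n), len x < L → σ i * x = σ j * y → Completes i x j y)
    {i j k : Fin (n - 1)} (hik : Adj i k) (hkj : Far k j) (hij : Adj i j) {s t : BraidMonoid n}
    (hL : len s + 2 ≤ L) (e : σ i * (σ k * s) = σ j * t) :
    Completes i (σ k * (σ i * s)) j (σ k * t) := by
  have hl := congrArg len e
  simp only [len_mul, len_σ] at hl
  obtain ⟨a, h1, rfl⟩ := (H _ _ _ _ (by simp; omega) e).of_adj hij
  simp only [len_mul, len_σ] at hl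
  obtain ⟨u, rfl, h2⟩ := (H _ _ _ _ (by omega) h1).of_far hkj
  obtain ⟨v, rfl, rfl⟩ := (H _ _ _ _ (by omega) h2).of_adj hik
  refine Or.inr (Or.inr ⟨hij, σ k * (σ i * (σ j * v)), ?_, ?_⟩)
  · rw [hij.braid (σ k * v), hkj.comm (σ i * (σ j * (σ k * v))), hkj.symm.comm v,
      hik.symm.braid (σ j * v)]
  · rw [hkj.symm.comm (σ i * v), hik.symm.braid (σ j * (σ i * v)), hij.braid v,
      hkj.comm (σ i * (σ j * v))]

/-- Transitivity of `Completes`, assuming the local least common multiple property for shorter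
braids. -/
theorem Completes.trans {L : ℕ}
    (H : ∀ i j (x y : BraidMonoid n), len x < L → σ i * x = σ j * y → Completes i x j y)
    {i j k : Fin (n - 1)} {x y w : BraidMonoid n} (hL : len w ≤ L)
    (h₁ : Completes i x k w) (h₂ : Completes k w j y) : Completes i x j y := by
  rcases h₁ with ⟨rfl, rfl⟩ | ⟨hik, s, rfl, hw⟩ | ⟨hik, s, rfl, hw⟩
  · exact h₂
  · rcases h₂ with ⟨rfl, rfl⟩ | ⟨hkj, t, hw', rfl⟩ | ⟨hkj, t, hw', rfl⟩
    · exact Or.inr (Or.inl ⟨hik, s, rfl, hw⟩)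
    · have e := hw.symm.trans hw'
      have hl := congrArg len hw
      have hl' := congrArg len e
      simp only [len_mul, len_σ] at hl hl'
      have C := H _ _ _ _ (by omega) e
      rcases C with ⟨rfl, rfl⟩ | ⟨hij, z, rfl, rfl⟩ | ⟨hij, z, rfl, rfl⟩
      · exact Or.inl ⟨rfl, rfl⟩
      · exact Or.inr (Or.inl ⟨hij, σ k * z, hkj.comm z, hik.symm.comm z⟩)
      · refine Or.inr (Or.inr ⟨hij, σ k * z, ?_, ?_⟩)
        · rw [hkj.comm, hik.symm.comm]
        · rw [hik.symm.comm, hkj.comm]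
    · have e := hw.symm.trans hw'
      have hl := congrArg len hw
      have hl' := congrArg len e
      simp only [len_mul, len_σ] at hl hl'
      rcases eq_or_far_or_adj i j with rfl | hij | hij
      · exact absurd hkj.symm hik.not_adj
      · have C := H _ _ _ _ (by omega) e
        obtain ⟨a, rfl, h1⟩ := C.of_far hij
        obtain ⟨u, rfl, rfl⟩ := (H _ _ _ _ (by omega) h1).of_far hik.symm
        refine Or.inr (Or.inl ⟨hij, σ k * (σ j * u), ?_, ?_⟩)
        · rw [hkj.braid u]
        · rw [hij.symm.comm, hik.symm.comm]
      · exact (completes_of_adj_far_adj H hkj.symm hik.symm hij.symm (by omega) e.symm).symm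
  · rcases h₂ with ⟨rfl, rfl⟩ | ⟨hkj, t, hw', rfl⟩ | ⟨hkj, t, hw', rfl⟩
    · exact Or.inr (Or.inr ⟨hik, s, rfl, hw⟩)
    · have e := hw.symm.trans hw'
      have hl := congrArg len hw
      have hl' := congrArg len e
      simp only [len_mul, len_σ] at hl hl'
      rcases eq_or_far_or_adj i j with rfl | hij | hij
      · exact absurd hik.symm hkj.not_adj
      · obtain ⟨a, h1, rfl⟩ := (H _ _ _ _ (by simp; omega) e).of_far hij
        obtain ⟨u, rfl, rfl⟩ := (H _ _ _ _ (by omega) h1).of_far hkj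
        refine Or.inr (Or.inl ⟨hij, σ k * (σ i * u), ?_, ?_⟩)
        · rw [hij.comm, hkj.comm]
        · rw [hik.braid u]
      · exact completes_of_adj_far_adj H hik hkj hij (by omega) e
    · have e := hw.symm.trans hw'
      have hl := congrArg len hw
      have hl' := congrArg len e
      simp only [len_mul, len_σ] at hl hl'
      rcases eq_or_far_or_adj i j with rfl | hij | hij
      · have h1 := (H _ _ _ _ (by simp; omega) e).eq
        exact Or.inl ⟨rfl, by rw [(H _ _ _ _ (by omega) h1).eq]⟩
      · exact completes_of_adj_adj_far H hik hkj hij (by omega) e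
      · unfold Adj at *
        omega

/-- If shorter braids have the local least common multiple property, then cutting off the first
letters of two equivalent words leaves braids that complete each other. -/
theorem completes_of_rel {L : ℕ}
    (H : ∀ i j (x y : BraidMonoid n), len x < L → σ i * x = σ j * y → Completes i x j y)
    {u v : FreeMonoid (Fin (n - 1))} (h : ConGen.Rel (braidRels n) u v) :
    ∀ i j u' v', u = .of i * u' → v = .of j * v' → u'.length ≤ L →
      Completes i (mk n u') j (mk n v') := by
  induction h with
  | of x y h =>
    rintro i j u' v' hu hv -
    rcases h with ⟨a, b, hab, rfl, rfl⟩ | ⟨a, b, hab, rfl, rfl⟩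
    · obtain ⟨rfl, rfl⟩ := List.cons.inj hu
      obtain ⟨rfl, rfl⟩ := List.cons.inj hv
      exact Or.inr (Or.inr ⟨Or.inl hab, 1, by rw [mul_one]; rfl, by rw [mul_one]; rfl⟩)
    · obtain ⟨rfl, rfl⟩ := List.cons.inj hu
      obtain ⟨rfl, rfl⟩ := List.cons.inj hv
      exact Or.inr (Or.inl ⟨Or.inl hab, 1, by rw [mul_one]; rfl, by rw [mul_one]; rfl⟩)
  | refl x =>
    rintro i j u' v' hu hv -
    obtain ⟨rfl, rfl⟩ := List.cons.inj (hu.symm.trans hv)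
    exact Or.inl ⟨rfl, rfl⟩
  | symm h ih =>
    rintro i j u' v' rfl rfl hL
    refine (ih j i v' u' rfl rfl ?_).symm
    have := congrArg len (mk_eq_mk_iff.2 h)
    simp only [len_mk, FreeMonoid.length_mul, FreeMonoid.length_of] at this
    omega
  | @trans x y z h₁ h₂ ih₁ ih₂ =>
    rintro i j u' v' rfl rfl hL
    have hl := congrArg len (mk_eq_mk_iff.2 h₁)
    simp only [len_mk, FreeMonoid.length_mul, FreeMonoid.length_of] at hl
    cases y with
    | one => simp at hl
    | of_mul k w =>
      simp only [FreeMonoid.length_mul, FreeMonoid.length_of] at hl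
      have hw : len (mk n w) ≤ L := by rw [len_mk]; omega
      exact (ih₁ i k u' w rfl rfl hL).trans H hw (ih₂ k j w v' rfl rfl (by omega))
  | @mul w x y z h₁ h₂ ih₁ ih₂ =>
    rintro i j u' v' hu hv hL
    have hl := congrArg len (mk_eq_mk_iff.2 h₁)
    rw [len_mk, len_mk] at hl
    cases w with
    | one =>
      obtain rfl : x = 1 := FreeMonoid.length_eq_zero.1 hl.symm
      rw [one_mul] at hu hv
      exact ih₂ i j u' v' hu hv hL
    | of_mul k w' =>
      cases x with
      | one => simp at hl
      | of_mul l x' =>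
        rw [mul_assoc] at hu hv
        obtain ⟨rfl, rfl⟩ := List.cons.inj hu
        obtain ⟨rfl, rfl⟩ := List.cons.inj hv
        have hw : w'.length ≤ L := by
          have : (w' * y).length ≤ L := hL
          rw [FreeMonoid.length_mul] at this
          omega
        have := (ih₁ k l w' x' rfl rfl hw).mul_right (mk n y)
        change Completes k (mk n (w' * y)) l (mk n (x' * z))
        rw [map_mul, map_mul, ← mk_eq_mk_iff.2 h₂]
        exact this

/-- Two generators have a least common right-multiple. -/
theorem completes_of_σ_mul_eq {i j : Fin (n - 1)} {x y : BraidMonoid n}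
    (h : σ i * x = σ j * y) : Completes i x j y := by
  have key : ∀ L i j (x y : BraidMonoid n), len x < L → σ i * x = σ j * y →
      Completes i x j y := by
    intro L
    induction L with
    | zero => intro _ _ _ _ h; omega
    | succ L ih =>
      intro i j x y hx h
      obtain ⟨u, rfl⟩ := mk_surjective x
      obtain ⟨v, rfl⟩ := mk_surjective y
      rw [len_mk] at hx
      rw [← mk_of, ← mk_of, ← map_mul, ← map_mul] at h
      exact completes_of_rel ih (mk_eq_mk_iff.1 h) i j u v rfl rfl (by omega)
  exact key _ i j x y (Nat.lt_succ_self _) h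

instance : IsLeftCancelMul (BraidMonoid n) where
  mul_left_cancel a x y h := by
    obtain ⟨u, rfl⟩ := mk_surjective a
    induction u generalizing x y with
    | one => simpa using h
    | of i => exact (completes_of_σ_mul_eq h).eq
    | mul u v hu hv =>
      refine hv _ _ (hu _ _ ?_)
      simpa [mul_assoc] using h

end BraidMonoid

namespace LeftDvd

variable {M : Type*} [Monoid M] {a b c : M}

theorem refl (a : M) : LeftDvd a a := ⟨1, (mul_one a).symm⟩

theorem one_left (a : M) : LeftDvd 1 a := ⟨a, (one_mul a).symm⟩

theorem mul_right (h : LeftDvd a b) (c : M) : LeftDvd a (b * c) := by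
  obtain ⟨d, rfl⟩ := h
  exact ⟨d * c, mul_assoc a d c⟩

theorem trans (h₁ : LeftDvd a b) (h₂ : LeftDvd b c) : LeftDvd a c := by
  obtain ⟨d, rfl⟩ := h₂
  exact h₁.mul_right d

theorem mul_left (c : M) (h : LeftDvd a b) : LeftDvd (c * a) (c * b) := by
  obtain ⟨d, rfl⟩ := h
  exact ⟨d, (mul_assoc c a d).symm⟩

theorem of_mul_left [IsLeftCancelMul M] (h : LeftDvd (c * a) (c * b)) : LeftDvd a b := by
  obtain ⟨d, h⟩ := h
  exact ⟨d, mul_left_cancel (h.trans (mul_assoc c a d))⟩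

end LeftDvd

namespace BraidMonoid

variable {n : ℕ}

theorem len_le_of_leftDvd {a b : BraidMonoid n} (h : LeftDvd a b) : len a ≤ len b := by
  obtain ⟨c, rfl⟩ := h
  simp

theorem eq_of_leftDvd_of_len_le {a b : BraidMonoid n} (h : LeftDvd a b) (hl : len b ≤ len a) :
    a = b := by
  obtain ⟨c, rfl⟩ := h
  rw [len_mul] at hl
  rw [len_eq_zero.1 (by omega : len c = 0), mul_one]

theorem leftDvd_antisymm {a b : BraidMonoid n} (h₁ : LeftDvd a b) (h₂ : LeftDvd b a) : a = b :=
  eq_of_leftDvd_of_len_le h₁ (len_le_of_leftDvd h₂)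

/-- The complements of two generators in their least common multiple. -/
theorem exists_complement (i j : Fin (n - 1)) : ∃ p q : BraidMonoid n, σ i * p = σ j * q ∧
    ∀ x y, σ i * x = σ j * y → ∃ z, x = p * z ∧ y = q * z := by
  rcases eq_or_far_or_adj i j with rfl | h | h
  · exact ⟨1, 1, rfl, fun x y e => ⟨x, by simp, by simp [mul_left_cancel e]⟩⟩
  · refine ⟨σ j, σ i, by simpa using h.comm 1, fun x y e => ?_⟩
    exact (completes_of_σ_mul_eq e).of_far h
  · refine ⟨σ j * σ i, σ i * σ j, by simpa using h.braid 1, fun x y e => ?_⟩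
    simpa only [mul_assoc] using (completes_of_σ_mul_eq e).of_adj h

/-- Two positive braids with a common right-multiple have a least one. -/
theorem exists_lcm {a b c : BraidMonoid n} (ha : LeftDvd a c) (hb : LeftDvd b c) :
    ∃ m, LeftDvd a m ∧ LeftDvd b m ∧ ∀ d, LeftDvd a d → LeftDvd b d → LeftDvd m d := by
  induction h : len c using Nat.strong_induction_on generalizing a b c with
  | _ N ih =>
    subst h
    by_cases ha1 : a = 1
    · subst ha1
      exact ⟨b, LeftDvd.one_left b, LeftDvd.refl b, fun d _ h => h⟩
    by_cases hb1 : b = 1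
    · subst hb1
      exact ⟨a, LeftDvd.refl a, LeftDvd.one_left a, fun d h _ => h⟩
    obtain ⟨i, a, rfl⟩ := eq_σ_mul ha1
    obtain ⟨j, b, rfl⟩ := eq_σ_mul hb1
    obtain ⟨p, q, hpq, hc⟩ := exists_complement i j
    have split : ∀ d, LeftDvd (σ i * a) d → LeftDvd (σ j * b) d → ∃ z, d = σ i * (p * z) ∧
        LeftDvd a (p * z) ∧ LeftDvd b (q * z) := by
      rintro d ⟨x, hx⟩ ⟨y, hy⟩
      rw [mul_assoc] at hx hy
      obtain ⟨z, hz, hz'⟩ := hc _ _ (hx.symm.trans hy)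
      exact ⟨z, by rw [hx, hz], ⟨x, hz.symm⟩, ⟨y, hz'.symm⟩⟩
    obtain ⟨z, rfl, haz, hbz⟩ := split c ha hb
    have hl := congrArg len hpq
    simp only [len_mul, len_σ] at hl ih
    obtain ⟨m₁, ham, ⟨r, rfl⟩, hm₁⟩ :=
      ih _ (by omega) haz (LeftDvd.mul_right (LeftDvd.refl p) z) (len_mul p z)
    obtain ⟨m₂, hbm, ⟨s, rfl⟩, hm₂⟩ :=
      ih _ (by omega) hbz (LeftDvd.mul_right (LeftDvd.refl q) z) (len_mul q z)
    have univ : ∀ z, LeftDvd a (p * z) → LeftDvd b (q * z) → LeftDvd r z ∧ LeftDvd s z :=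
      fun z h h' => ⟨(hm₁ _ h ⟨z, rfl⟩).of_mul_left, (hm₂ _ h' ⟨z, rfl⟩).of_mul_left⟩
    obtain ⟨hrz, hsz⟩ := univ z haz hbz
    obtain ⟨m, hrm, hsm, hm⟩ := ih _ (by omega) hrz hsz rfl
    refine ⟨σ i * (p * m), (ham.trans (hrm.mul_left p)).mul_left _, ?_, fun d hd hd' => ?_⟩
    · rw [← mul_assoc, hpq, mul_assoc]
      exact (hbm.trans (hsm.mul_left q)).mul_left _
    · obtain ⟨y, rfl, hy, hy'⟩ := split d hd hd'
      obtain ⟨h, h'⟩ := univ y hy hy'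
      exact ((hm y h h').mul_left p).mul_left _

/-- Any two positive braids have a greatest common left-divisor. -/
theorem exists_isGCLD (a b : BraidMonoid n) : ∃ d, IsGCLD a b d := by
  let S : Set ℕ := len '' {d : BraidMonoid n | LeftDvd d a ∧ LeftDvd d b}
  have hbdd : BddAbove S := by
    refine ⟨len a, ?_⟩
    rintro _ ⟨d, hd, rfl⟩
    exact len_le_of_leftDvd hd.1
  have hne : S.Nonempty := ⟨_, 1, ⟨LeftDvd.one_left a, LeftDvd.one_left b⟩, rfl⟩
  obtain ⟨d, ⟨hda, hdb⟩, hd⟩ := Nat.sSup_mem hne hbdd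
  refine ⟨d, hda, hdb, fun e hea heb => ?_⟩
  obtain ⟨m, hdm, hem, hm⟩ := exists_lcm hda hea
  have hl : len m ≤ sSup S := le_csSup hbdd ⟨m, ⟨hm a hda hea, hm b hdb heb⟩, rfl⟩
  rw [← hd] at hl
  rwa [eq_of_leftDvd_of_len_le hdm hl]

theorem isGCLD_unique {a b d e : BraidMonoid n} (hd : IsGCLD a b d) (he : IsGCLD a b e) : d = e :=
  leftDvd_antisymm (he.2.2 d hd.1 hd.2.1) (hd.2.2 e he.1 he.2.1)

theorem desc_succ {k : ℕ} (h : k < n - 1) : desc n (k + 1) = σ ⟨k, h⟩ * desc n k := by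
  simp [desc, h]

theorem commute_σ_desc {j : Fin (n - 1)} {k : ℕ} (h : k + 1 ≤ j) : Commute (σ j) (desc n k) := by
  induction k with
  | zero => exact Commute.one_right _
  | succ k ih =>
    rw [desc_succ (by omega)]
    refine Commute.mul_right ?_ (ih (by omega))
    have hf : Far j ⟨k, by omega⟩ := Or.inr h
    simpa [Commute, SemiconjBy] using hf.comm 1

theorem commute_σ_deltaAux {j : Fin (n - 1)} {m : ℕ} (h : m ≤ j) :
    Commute (σ j) (deltaAux n m) := by
  induction m with
  | zero => exact Commute.one_right _
  | succ m ih => exact (ih (by omega)).mul_right (commute_σ_desc h)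

theorem leftDvd_desc_mul_desc {k : ℕ} (h : k < n - 1) :
    LeftDvd (σ ⟨k, h⟩) (desc n k * desc n (k + 1)) := by
  induction k with
  | zero => exact ⟨1, by simp [desc, h]⟩
  | succ k ih =>
    have hk : k < n - 1 := by omega
    obtain ⟨w, hw⟩ := ih hk
    have hadj : Adj (⟨k, hk⟩ : Fin (n - 1)) ⟨k + 1, h⟩ := Or.inl rfl
    have hcomm : Commute (σ ⟨k + 1, h⟩) (desc n k) := commute_σ_desc le_rfl
    refine ⟨σ ⟨k, hk⟩ * (σ ⟨k + 1, h⟩ * w), ?_⟩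
    rw [← hadj.braid, ← hw, desc_succ h, desc_succ hk, mul_assoc, ← hcomm.left_comm,
      ← desc_succ hk]

theorem σ_leftDvd_deltaAux {m : ℕ} (i : Fin (n - 1)) (h : i + 2 ≤ m) :
    LeftDvd (σ i) (deltaAux n m) := by
  induction m with
  | zero => omega
  | succ m ih =>
    by_cases him : i + 2 ≤ m
    · exact (ih him).mul_right _
    · obtain rfl : m = i + 1 := by omega
      obtain ⟨w, hw⟩ := leftDvd_desc_mul_desc i.2
      refine ⟨deltaAux n i * w, ?_⟩
      rw [← mul_assoc, (commute_σ_deltaAux le_rfl).eq, mul_assoc, ← hw, ← mul_assoc]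
      rfl

/-- Every generator left-divides Garside's fundamental element. -/
theorem σ_leftDvd_Δ (i : Fin (n - 1)) : LeftDvd (σ i) (Δ n) :=
  σ_leftDvd_deltaAux i (by omega)

theorem IsGCLD.ne_one {g d : BraidMonoid n} (hg : g ≠ 1) (hd : IsGCLD g (Δ n) d) : d ≠ 1 := by
  rintro rfl
  obtain ⟨i, y, rfl⟩ := eq_σ_mul hg
  have := len_le_of_leftDvd (hd.2.2 (σ i) ⟨y, rfl⟩ (σ_leftDvd_Δ i))
  simp at this

theorem forall_isGCLD_cons {x : BraidMonoid n} {l : List (BraidMonoid n)} :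
    (∀ i : Fin (x :: l).length,
      IsGCLD (((x :: l).drop (i : ℕ)).prod) (Δ n) ((x :: l).get i)) ↔
    IsGCLD (x * l.prod) (Δ n) x ∧
      ∀ i : Fin l.length, IsGCLD ((l.drop (i : ℕ)).prod) (Δ n) (l.get i) := by
  simp [Fin.forall_fin_succ]

/-- The greedy normal form, with the empty decomposition for the trivial braid. -/
theorem existsUnique_greedy (g : BraidMonoid n) :
    ∃! l : List (BraidMonoid n),
      l.prod = g ∧
      (∀ x ∈ l, x ≠ 1 ∧ LeftDvd x (Δ n)) ∧
      ∀ i : Fin l.length, IsGCLD ((l.drop (i : ℕ)).prod) (Δ n) (l.get i) := by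
  induction hN : len g using Nat.strong_induction_on generalizing g with
  | _ N ih =>
    subst hN
    by_cases hg : g = 1
    · subst hg
      refine ⟨[], ⟨rfl, by simp, fun i => i.elim0⟩, ?_⟩
      rintro (_ | ⟨x, l⟩) ⟨hl, hx, -⟩
      · rfl
      · have := congrArg len hl
        rw [List.prod_cons, len_mul, len_one] at this
        exact absurd (len_eq_zero.1 (by omega)) (hx x (by simp)).1
    · obtain ⟨d, hd⟩ := exists_isGCLD g (Δ n)
      have hd1 : d ≠ 1 := IsGCLD.ne_one hg hd
      obtain ⟨y, rfl⟩ := hd.1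
      have hlen : len d ≠ 0 := fun h => hd1 (len_eq_zero.1 h)
      obtain ⟨l, ⟨rfl, hmem, hl⟩, huniq⟩ := ih (len y) (by rw [len_mul]; omega) y rfl
      refine ⟨d :: l, ⟨by simp, ?_, forall_isGCLD_cons.2 ⟨hd, hl⟩⟩, ?_⟩
      · simpa using ⟨⟨hd1, hd.2.1⟩, hmem⟩
      · rintro (_ | ⟨x, l'⟩) ⟨hprod, hmem', hl'⟩
        · exact absurd hprod.symm hg
        · obtain ⟨hx, hl'⟩ := forall_isGCLD_cons.1 hl'
          rw [List.prod_cons] at hprod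
          rw [hprod] at hx
          obtain rfl := isGCLD_unique hx hd
          rw [huniq l' ⟨mul_left_cancel hprod,
            fun z hz => hmem' z (List.mem_cons_of_mem _ hz), hl'⟩]

end BraidMonoid

/-- Greedy normal form: every `g ≠ 1` in `B_n⁺` admits a unique decomposition
`g = g_1 g_2 ⋯ g_p` where each `g_i` is a left-divisor of `Δ_n` different from `1` and
each `g_i` is a greatest common left-divisor of `g_i g_{i+1} ⋯ g_p` and `Δ_n`. -/
theorem braidMonoid_greedy_normal_form (n : ℕ) (hn : 1 ≤ n) (g : BraidMonoid n)
    (hg : g ≠ 1) :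
    ∃! l : List (BraidMonoid n),
      l.prod = g ∧
      (∀ x ∈ l, x ≠ 1 ∧ LeftDvd x (Δ n)) ∧
      ∀ i : Fin l.length, IsGCLD ((l.drop (i : ℕ)).prod) (Δ n) (l.get i) :=
  BraidMonoid.existsUnique_greedy g
end

section
/- The left-divisors of Δ_n in the positive braid monoid B_n^+ are in bijection with the symmetric group S_n: the canonical homomorphism π : B_n^+ → S_n sending σ_i to the transposition (i, i+1) restricts to a bijection from the set of left-divisors of Δ_n onto S_n. -/
/-- The adjacent transposition `(i+1, i+2)` of `{1, …, n}`, i.e. the permutation of `Fin n`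
swapping `i` and `i + 1` (0-based index `i : Fin (n - 1)`). -/
def adjSwap {n : ℕ} (i : Fin (n - 1)) : Equiv.Perm (Fin n) :=
  Equiv.swap ⟨i, by have := i.isLt; omega⟩ ⟨i + 1, by have := i.isLt; omega⟩

theorem swap_conj {n : ℕ} (x y u v : Fin n) :
    Equiv.swap x y * Equiv.swap u v * Equiv.swap x y =
      Equiv.swap (Equiv.swap x y u) (Equiv.swap x y v) := by
  rw [Equiv.swap_apply_apply, Equiv.swap_inv]

theorem swap_commute {n : ℕ} (x y u v : Fin n) (h1 : u ≠ x) (h2 : u ≠ y) (h3 : v ≠ x)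
    (h4 : v ≠ y) : Equiv.swap x y * Equiv.swap u v = Equiv.swap u v * Equiv.swap x y := by
  have key := swap_conj x y u v
  rw [Equiv.swap_apply_of_ne_of_ne h1 h2, Equiv.swap_apply_of_ne_of_ne h3 h4] at key
  calc Equiv.swap x y * Equiv.swap u v
      = Equiv.swap x y * Equiv.swap u v * Equiv.swap x y * Equiv.swap x y := by
        rw [mul_assoc, Equiv.swap_mul_self, mul_one]
    _ = Equiv.swap u v * Equiv.swap x y := by rw [key]

theorem adjSwap_braid {n : ℕ} (i j : Fin (n - 1)) (hij : (i : ℕ) + 1 = (j : ℕ)) :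
    adjSwap (n := n) i * adjSwap j * adjSwap i = adjSwap j * adjSwap i * adjSwap j := by
  have hi := i.isLt; have hj := j.isLt
  set a : Fin n := ⟨i, by omega⟩ with ha
  set b : Fin n := ⟨i + 1, by omega⟩ with hb
  set c : Fin n := ⟨j + 1, by omega⟩ with hc
  have hab : a ≠ b := by simp [ha, hb, Fin.ext_iff]
  have hbc : b ≠ c := by simp [hb, hc, Fin.ext_iff]; omega
  have hac : a ≠ c := by simp [ha, hc, Fin.ext_iff]; omega
  have hj' : adjSwap (n := n) j = Equiv.swap b c := by
    unfold adjSwap; congr 1; simp [hb, Fin.ext_iff]; omega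
  have hi' : adjSwap (n := n) i = Equiv.swap a b := rfl
  rw [hi', hj']
  have e1 : Equiv.swap a b * Equiv.swap b c * Equiv.swap a b = Equiv.swap a c := by
    rw [swap_conj, Equiv.swap_apply_right, Equiv.swap_apply_of_ne_of_ne hac.symm hbc.symm]
  have e2 : Equiv.swap b c * Equiv.swap a b * Equiv.swap b c = Equiv.swap a c := by
    rw [swap_conj, Equiv.swap_apply_of_ne_of_ne hab hac, Equiv.swap_apply_left,
      Equiv.swap_comm]
  rw [e1, e2]

theorem adjSwap_comm {n : ℕ} (i j : Fin (n - 1)) (hij : (i : ℕ) + 2 ≤ (j : ℕ)) :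
    adjSwap (n := n) i * adjSwap j = adjSwap j * adjSwap i := by
  have hi := i.isLt; have hj := j.isLt
  apply swap_commute <;> simp [adjSwap, Fin.ext_iff] <;> omega

theorem braidRels_hold_perm (n : ℕ) (a b : FreeMonoid (Fin (n - 1))) (h : braidRels n a b) :
    FreeMonoid.lift (fun i => adjSwap (n := n) i) a =
      FreeMonoid.lift (fun i => adjSwap (n := n) i) b := by
  obtain ⟨i, j, hij, rfl, rfl⟩ | ⟨i, j, hij, rfl, rfl⟩ := h
  · simp only [map_mul, FreeMonoid.lift_eval_of]
    exact adjSwap_braid i j hij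
  · simp only [map_mul, FreeMonoid.lift_eval_of]
    exact adjSwap_comm i j hij

/-- The canonical homomorphism `π : B_n⁺ →* S_n` sending the generator `σ_i` to the
transposition `(i, i+1)`. -/
def braidPerm (n : ℕ) : BraidMonoid n →* Equiv.Perm (Fin n) :=
  PresentedMonoid.lift (fun i => adjSwap (n := n) i) (braidRels_hold_perm n)

theorem braidPerm_sigma (n : ℕ) (i : Fin (n - 1)) : braidPerm n (σ i) = adjSwap i := rfl

namespace BraidMonoid

variable {n : ℕ}

/-- The position `i`, the smaller of the two points exchanged by `adjSwap i`. -/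
def lo (i : Fin (n - 1)) : Fin n := ⟨i, by have := i.isLt; omega⟩

/-- The position `i + 1`, the larger of the two points exchanged by `adjSwap i`. -/
def hi (i : Fin (n - 1)) : Fin n := ⟨i + 1, by have := i.isLt; omega⟩

@[simp] theorem lo_val (i : Fin (n - 1)) : (lo i : ℕ) = i := rfl

@[simp] theorem hi_val (i : Fin (n - 1)) : (hi i : ℕ) = i + 1 := rfl

theorem lo_lt_hi (i : Fin (n - 1)) : lo i < hi i := Nat.lt_succ_self _

@[simp] theorem adjSwap_lo (i : Fin (n - 1)) : adjSwap i (lo i) = hi i :=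
  Equiv.swap_apply_left _ _

@[simp] theorem adjSwap_hi (i : Fin (n - 1)) : adjSwap i (hi i) = lo i :=
  Equiv.swap_apply_right _ _

theorem adjSwap_of_ne {i : Fin (n - 1)} {x : Fin n} (h : x ≠ lo i) (h' : x ≠ hi i) :
    adjSwap i x = x :=
  Equiv.swap_apply_of_ne_of_ne h h'

@[simp] theorem adjSwap_mul_self (i : Fin (n - 1)) : adjSwap i * adjSwap i = 1 :=
  Equiv.swap_mul_self _ _

theorem adjSwap_adjSwap (i : Fin (n - 1)) (x : Fin n) : adjSwap i (adjSwap i x) = x :=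
  DFunLike.congr_fun (adjSwap_mul_self i) x

theorem mul_adjSwap_cancel (w : Equiv.Perm (Fin n)) (i : Fin (n - 1)) :
    w * adjSwap i * adjSwap i = w := by
  rw [mul_assoc, adjSwap_mul_self, mul_one]

theorem adjSwap_val (i : Fin (n - 1)) (x : Fin n) :
    (adjSwap i x : ℕ) = if (x : ℕ) = i then (i : ℕ) + 1 else if (x : ℕ) = i + 1 then (i : ℕ)
      else x := by
  split_ifs with h h'
  · rw [show x = lo i from Fin.ext h, adjSwap_lo, hi_val]
  · rw [show x = hi i from Fin.ext h', adjSwap_hi, lo_val]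
  · rw [adjSwap_of_ne (fun e => h (by simp [e])) (fun e => h' (by simp [e]))]

/-- The inversions of a permutation of `Fin n`. -/
def inversions (w : Equiv.Perm (Fin n)) : Finset (Fin n × Fin n) :=
  Finset.univ.filter fun p => p.1 < p.2 ∧ w p.2 < w p.1

@[simp] theorem mem_inversions {w : Equiv.Perm (Fin n)} {p : Fin n × Fin n} :
    p ∈ inversions w ↔ p.1 < p.2 ∧ w p.2 < w p.1 := by
  simp [inversions]

/-- The number of inversions of a permutation of `Fin n`. -/
def inv (w : Equiv.Perm (Fin n)) : ℕ := (inversions w).card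

theorem adjSwap_lt_adjSwap {i : Fin (n - 1)} {x y : Fin n} (h : x < y)
    (hne : ¬(x = lo i ∧ y = hi i)) : adjSwap i x < adjSwap i y := by
  rw [Fin.lt_def] at h ⊢
  simp only [Fin.ext_iff, lo_val, hi_val] at hne
  rw [adjSwap_val, adjSwap_val]
  split_ifs <;> omega

theorem inv_mul_adjSwap_of_lt {w : Equiv.Perm (Fin n)} {i : Fin (n - 1)}
    (h : w (lo i) < w (hi i)) : inv (w * adjSwap i) = inv w + 1 := by
  have key : inversions (w * adjSwap i) = insert (lo i, hi i)
      ((inversions w).map ((adjSwap i).prodCongr (adjSwap i)).toEmbedding) := by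
    ext ⟨x, y⟩
    rw [Finset.mem_insert, Finset.mem_map_equiv]
    have hsymm : (adjSwap i).symm = adjSwap i := Equiv.symm_swap _ _
    simp only [mem_inversions, Equiv.Perm.mul_apply, Prod.mk.injEq, Equiv.prodCongr_symm,
      Equiv.prodCongr_apply, Prod.map, hsymm]
    constructor
    · rintro ⟨hxy, hw⟩
      by_cases hne : x = lo i ∧ y = hi i
      · exact Or.inl hne
      · exact Or.inr ⟨adjSwap_lt_adjSwap hxy hne, hw⟩
    · rintro (⟨rfl, rfl⟩ | ⟨hxy, hw⟩)
      · exact ⟨lo_lt_hi i, by simpa using h⟩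
      · refine ⟨?_, hw⟩
        have := adjSwap_lt_adjSwap (i := i) hxy (fun hne => by
          rw [hne.1, hne.2] at hw
          exact absurd hw h.not_gt)
        simpa only [adjSwap_adjSwap] using this
  rw [inv, key, Finset.card_insert_of_notMem, Finset.card_map, inv]
  rw [Finset.mem_map_equiv]
  have hsymm : (adjSwap i).symm = adjSwap i := Equiv.symm_swap _ _
  simp [hsymm, (lo_lt_hi i).not_gt]

theorem inv_mul_adjSwap_of_gt {w : Equiv.Perm (Fin n)} {i : Fin (n - 1)}
    (h : w (hi i) < w (lo i)) : inv (w * adjSwap i) + 1 = inv w := by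
  rw [← inv_mul_adjSwap_of_lt (w := w * adjSwap i) (i := i) (by simpa using h),
    mul_adjSwap_cancel]

theorem lt_or_gt (w : Equiv.Perm (Fin n)) (i : Fin (n - 1)) :
    w (lo i) < w (hi i) ∨ w (hi i) < w (lo i) :=
  lt_or_gt_of_ne fun h => by simpa [Fin.ext_iff] using w.injective h

theorem inv_mul_adjSwap_le (w : Equiv.Perm (Fin n)) (i : Fin (n - 1)) :
    inv (w * adjSwap i) ≤ inv w + 1 := by
  rcases lt_or_gt w i with h | h
  · exact (inv_mul_adjSwap_of_lt h).le
  · have := inv_mul_adjSwap_of_gt h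
    omega

@[simp] theorem inv_one : inv (1 : Equiv.Perm (Fin n)) = 0 := by
  rw [inv, Finset.card_eq_zero, Finset.eq_empty_iff_forall_notMem]
  rintro ⟨x, y⟩ h
  rw [mem_inversions] at h
  exact absurd h.1 h.2.not_gt

theorem strictMono_of_lo_lt_hi {w : Equiv.Perm (Fin n)}
    (h : ∀ i : Fin (n - 1), w (lo i) < w (hi i)) : StrictMono w := by
  rcases n with _ | m
  · exact fun x => x.elim0
  · exact Fin.strictMono_iff_lt_succ.2 fun i => h i

theorem eq_one_of_lo_lt_hi {w : Equiv.Perm (Fin n)}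
    (h : ∀ i : Fin (n - 1), w (lo i) < w (hi i)) : w = 1 := by
  have key := Subsingleton.elim
    ((strictMono_of_lo_lt_hi h).orderIsoOfSurjective _ w.surjective) (OrderIso.refl _)
  exact Equiv.ext fun x => DFunLike.congr_fun key x

theorem eq_rev_of_hi_lt_lo {w : Equiv.Perm (Fin n)}
    (h : ∀ i : Fin (n - 1), w (hi i) < w (lo i)) : w = Fin.revPerm := by
  have := eq_one_of_lo_lt_hi (w := Fin.revPerm * w) fun i => by simpa using h i
  ext x
  have hx : Fin.rev (w x) = x := by simpa using DFunLike.congr_fun this x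
  simp [← Fin.rev_eq_iff.1 hx]

theorem inv_revPerm : inv (Fin.revPerm : Equiv.Perm (Fin n)) = ∑ k ∈ Finset.range n, k := by
  have key : inversions (Fin.revPerm : Equiv.Perm (Fin n)) =
      (Finset.univ.sigma fun y : Fin n => Finset.Iio y).map
        ⟨fun p => (p.2, p.1), fun p q h => by
          rcases p; rcases q; simp_all⟩ := by
    ext ⟨x, y⟩
    simp only [mem_inversions, Fin.revPerm_apply, Fin.rev_lt_rev, and_self, Finset.mem_map,
      Finset.mem_sigma, Finset.mem_univ, Finset.mem_Iio, true_and, Sigma.exists]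
    exact ⟨fun h => ⟨y, x, h, rfl⟩, by rintro ⟨_, _, h, ⟨⟩⟩; exact h⟩
  rw [inv, key, Finset.card_map, Finset.card_sigma]
  simp [Finset.sum_range]

/-- The word length of a positive braid, as a monoid homomorphism. -/
def lengthHom (n : ℕ) : BraidMonoid n →* Multiplicative ℕ :=
  PresentedMonoid.lift (fun _ => Multiplicative.ofAdd 1) (by
    rintro a b (⟨i, j, -, rfl, rfl⟩ | ⟨i, j, -, rfl, rfl⟩) <;> rfl)

/-- The word length of a positive braid. -/
def length (a : BraidMonoid n) : ℕ := (lengthHom n a).toAdd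

@[simp] theorem length_one : length (1 : BraidMonoid n) = 0 := by simp [length]

@[simp] theorem length_mul (a b : BraidMonoid n) : length (a * b) = length a + length b := by
  simp [length]

@[simp] theorem length_sigma (i : Fin (n - 1)) : length (σ i : BraidMonoid n) = 1 := rfl

theorem induction_right {P : BraidMonoid n → Prop} (one : P 1)
    (mul : ∀ a i, P a → P (a * σ i)) (a : BraidMonoid n) : P a := by
  induction a using PresentedMonoid.inductionOn with
  | _ l =>
    induction l using List.reverseRecOn with
    | nil => exact one
    | append_singleton l i ih => exact mul _ i ih

theorem eq_one_or_eq_mul_sigma (a : BraidMonoid n) : a = 1 ∨ ∃ b i, a = b * σ i := by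
  induction a using induction_right with
  | one => exact Or.inl rfl
  | mul a i _ => exact Or.inr ⟨a, i, rfl⟩

theorem inv_braidPerm_mul_le (a b : BraidMonoid n) :
    inv (braidPerm n (a * b)) ≤ inv (braidPerm n a) + length b := by
  induction b using induction_right with
  | one => simp
  | mul b i ih =>
    have := inv_mul_adjSwap_le (braidPerm n (a * b)) i
    rw [← mul_assoc, map_mul, braidPerm_sigma, length_mul, length_sigma]
    omega

theorem inv_braidPerm_le (a : BraidMonoid n) : inv (braidPerm n a) ≤ length a := by
  simpa using inv_braidPerm_mul_le 1 a

/-- `a` is a minimal-length braid over the permutation `w`. -/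
structure IsReducedLift (a : BraidMonoid n) (w : Equiv.Perm (Fin n)) : Prop where
  perm_eq : braidPerm n a = w
  length_eq : length a = inv w

theorem IsReducedLift.of_mul {a b : BraidMonoid n} {w : Equiv.Perm (Fin n)}
    (h : IsReducedLift (a * b) w) : IsReducedLift a (braidPerm n a) := by
  refine ⟨rfl, ?_⟩
  have h1 := inv_braidPerm_mul_le a b
  have h2 := inv_braidPerm_le a
  have h3 := h.length_eq
  rw [h.perm_eq] at h1
  rw [length_mul] at h3
  omega

theorem IsReducedLift.of_mul_sigma {a : BraidMonoid n} {w : Equiv.Perm (Fin n)}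
    {i : Fin (n - 1)} (h : IsReducedLift (a * σ i) w) :
    IsReducedLift a (w * adjSwap i) ∧ w (hi i) < w (lo i) := by
  have hw : braidPerm n a = w * adjSwap i := by
    rw [← h.perm_eq, map_mul, braidPerm_sigma, mul_adjSwap_cancel]
  have ha := h.of_mul
  rw [hw] at ha
  refine ⟨ha, (lt_or_gt w i).resolve_left fun hlt => ?_⟩
  have h1 := inv_mul_adjSwap_of_lt hlt
  have h2 := ha.length_eq
  have h3 := h.length_eq
  rw [length_mul, length_sigma] at h3
  omega

theorem IsReducedLift.mul_sigma {a : BraidMonoid n} {w : Equiv.Perm (Fin n)}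
    {i : Fin (n - 1)} (h : IsReducedLift a (w * adjSwap i)) (hw : w (hi i) < w (lo i)) :
    IsReducedLift (a * σ i) w := by
  refine ⟨by rw [map_mul, h.perm_eq, braidPerm_sigma, mul_adjSwap_cancel], ?_⟩
  rw [length_mul, h.length_eq, length_sigma, inv_mul_adjSwap_of_gt hw]

theorem exists_isReducedLift (w : Equiv.Perm (Fin n)) : ∃ a, IsReducedLift a w := by
  induction h : inv w using Nat.strong_induction_on generalizing w with
  | _ k ih =>
    by_cases hw : ∀ i : Fin (n - 1), w (lo i) < w (hi i)
    · rw [eq_one_of_lo_lt_hi hw]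
      exact ⟨1, map_one _, by simp⟩
    · push Not at hw
      obtain ⟨i, hwi⟩ := hw
      have hgt := (lt_or_gt w i).resolve_left hwi.not_gt
      obtain ⟨a, ha⟩ := ih _ (by have := inv_mul_adjSwap_of_gt hgt; omega) (w * adjSwap i) rfl
      exact ⟨_, ha.mul_sigma hgt⟩

theorem sigma_braid {i j : Fin (n - 1)} (h : (i : ℕ) + 1 = j) :
    (σ i * σ j * σ i : BraidMonoid n) = σ j * σ i * σ j :=
  Quotient.sound (ConGen.Rel.of _ _ (Or.inl ⟨i, j, h, rfl, rfl⟩))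

theorem sigma_comm {i j : Fin (n - 1)} (h : (i : ℕ) + 2 ≤ j) :
    (σ i * σ j : BraidMonoid n) = σ j * σ i :=
  Quotient.sound (ConGen.Rel.of _ _ (Or.inr ⟨i, j, h, rfl, rfl⟩))

theorem exists_reducedLifts_mul_sigma_eq {w : Equiv.Perm (Fin n)} {i j : Fin (n - 1)}
    (hij : i < j) (hwi : w (hi i) < w (lo i)) (hwj : w (hi j) < w (lo j)) :
    ∃ x y, IsReducedLift x (w * adjSwap i) ∧ IsReducedLift y (w * adjSwap j) ∧
      x * σ i = y * σ j := by
  rw [Fin.lt_def] at hij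
  rcases Nat.lt_or_ge ((i : ℕ) + 1) j with hfar | hnear
  · obtain ⟨c, hc⟩ := exists_isReducedLift (w * adjSwap i * adjSwap j)
    have hc' : IsReducedLift c (w * adjSwap j * adjSwap i) := by
      rwa [mul_assoc, ← adjSwap_comm i j hfar, ← mul_assoc]
    refine ⟨_, _, hc.mul_sigma ?_, hc'.mul_sigma ?_, ?_⟩
    · rw [Equiv.Perm.mul_apply, Equiv.Perm.mul_apply, adjSwap_of_ne, adjSwap_of_ne]
      · exact hwj
      all_goals simp only [ne_eq, Fin.ext_iff, lo_val, hi_val]; omega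
    · rw [Equiv.Perm.mul_apply, Equiv.Perm.mul_apply, adjSwap_of_ne, adjSwap_of_ne]
      · exact hwi
      all_goals simp only [ne_eq, Fin.ext_iff, lo_val, hi_val]; omega
    · rw [mul_assoc, mul_assoc, sigma_comm hfar]
  · have hj : (i : ℕ) + 1 = j := by omega
    have hlo : lo j = hi i := Fin.ext hj.symm
    have hfix : adjSwap i (hi j) = hi j := by
      apply adjSwap_of_ne <;> simp only [ne_eq, Fin.ext_iff, lo_val, hi_val] <;> omega
    have hfix' : adjSwap j (lo i) = lo i := by
      apply adjSwap_of_ne <;> simp only [ne_eq, Fin.ext_iff, lo_val, hi_val] <;> omega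
    have hmid : adjSwap j (hi i) = hi j := by rw [← hlo, adjSwap_lo]
    have hmid' : adjSwap j (hi j) = hi i := by rw [← hlo, adjSwap_hi]
    rw [hlo] at hwj
    obtain ⟨c, hc⟩ := exists_isReducedLift (w * adjSwap i * adjSwap j * adjSwap i)
    have hc' : IsReducedLift c (w * adjSwap j * adjSwap i * adjSwap j) := by
      simpa only [mul_assoc, adjSwap_braid i j hj] using hc
    refine ⟨_, _, (hc.mul_sigma ?_).mul_sigma ?_, (hc'.mul_sigma ?_).mul_sigma ?_, ?_⟩
    · simpa [hmid, hfix, hfix'] using hwj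
    · simpa [hlo, hfix] using hwj.trans hwi
    · simpa [hlo, hfix, hfix', hmid'] using hwi
    · simpa [hmid, hfix'] using hwj.trans hwi
    · simpa only [mul_assoc] using congrArg (c * ·) (sigma_braid hj)

/-- Minimal-length positive braids are determined by their permutation. -/
theorem IsReducedLift.unique {a b : BraidMonoid n} {w : Equiv.Perm (Fin n)}
    (ha : IsReducedLift a w) (hb : IsReducedLift b w) : a = b := by
  induction h : inv w using Nat.strong_induction_on generalizing a b w with
  | _ k ih =>
    have hlen := ha.length_eq.trans hb.length_eq.symm
    obtain rfl | ⟨a, i, rfl⟩ := eq_one_or_eq_mul_sigma a <;>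
      obtain rfl | ⟨b, j, rfl⟩ := eq_one_or_eq_mul_sigma b
    · rfl
    · simp at hlen
    · simp at hlen
    · obtain ⟨ha, hwi⟩ := ha.of_mul_sigma
      obtain ⟨hb, hwj⟩ := hb.of_mul_sigma
      have hi_lt := inv_mul_adjSwap_of_gt hwi
      have hj_lt := inv_mul_adjSwap_of_gt hwj
      rcases lt_trichotomy i j with hij | rfl | hij
      · obtain ⟨x, y, hx, hy, hxy⟩ := exists_reducedLifts_mul_sigma_eq hij hwi hwj
        rw [ih _ (by omega) ha hx rfl, ih _ (by omega) hb hy rfl, hxy]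
      · rw [ih _ (by omega) ha hb rfl]
      · obtain ⟨x, y, hx, hy, hxy⟩ := exists_reducedLifts_mul_sigma_eq hij hwj hwi
        rw [ih _ (by omega) ha hy rfl, ih _ (by omega) hb hx rfl, hxy]

theorem braidPerm_desc_val {k : ℕ} (hk : k < n) (x : Fin n) :
    (braidPerm n (desc n k) x : ℕ) =
      if (x : ℕ) = 0 then k else if (x : ℕ) ≤ k then (x : ℕ) - 1 else x := by
  induction k with
  | zero =>
    rw [desc, map_one, Equiv.Perm.one_apply]
    split_ifs <;> omega
  | succ k ih =>
    have hk' : k < n - 1 := by omega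
    rw [desc, dif_pos hk', map_mul, braidPerm_sigma, Equiv.Perm.mul_apply, adjSwap_val,
      ih (by omega)]
    dsimp only
    split_ifs <;> omega

theorem braidPerm_deltaAux_val {m : ℕ} (hm : m ≤ n) (x : Fin n) :
    (braidPerm n (deltaAux n m) x : ℕ) = if (x : ℕ) < m then m - 1 - (x : ℕ) else x := by
  induction m generalizing x with
  | zero => simp [deltaAux]
  | succ m ih =>
    rw [deltaAux, map_mul, Equiv.Perm.mul_apply, ih (by omega), braidPerm_desc_val (by omega)]
    split_ifs <;> omega

theorem braidPerm_delta : braidPerm n (Δ n) = Fin.revPerm := by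
  ext x
  rw [Δ, braidPerm_deltaAux_val le_rfl, if_pos x.isLt, Fin.revPerm_apply, Fin.val_rev]
  omega

theorem length_desc {k : ℕ} (hk : k < n) : length (desc n k) = k := by
  induction k with
  | zero => simp [desc]
  | succ k ih =>
    have hk' : k < n - 1 := by omega
    rw [desc, dif_pos hk', length_mul, length_sigma, ih (by omega), add_comm]

theorem length_deltaAux {m : ℕ} (hm : m ≤ n) :
    length (deltaAux n m) = ∑ k ∈ Finset.range m, k := by
  induction m with
  | zero => simp [deltaAux]
  | succ m ih =>
    rw [deltaAux, length_mul, ih (by omega), length_desc (by omega), Finset.sum_range_succ]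

theorem isReducedLift_delta : IsReducedLift (Δ n) (Fin.revPerm : Equiv.Perm (Fin n)) :=
  ⟨braidPerm_delta, by rw [inv_revPerm, Δ, length_deltaAux le_rfl]⟩

theorem inv_le_card (w : Equiv.Perm (Fin n)) : inv w ≤ Fintype.card (Fin n × Fin n) :=
  Finset.card_le_univ _

theorem IsReducedLift.leftDvd_delta {a : BraidMonoid n} {w : Equiv.Perm (Fin n)}
    (h : IsReducedLift a w) : LeftDvd a (Δ n) := by
  induction hk : Fintype.card (Fin n × Fin n) - inv w using Nat.strong_induction_on
    generalizing a w with
  | _ k ih =>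
    by_cases hw : ∀ i : Fin (n - 1), w (hi i) < w (lo i)
    · rw [eq_rev_of_hi_lt_lo hw] at h
      exact ⟨1, by rw [mul_one, h.unique isReducedLift_delta]⟩
    · push Not at hw
      obtain ⟨i, hwi⟩ := hw
      have hlt := (lt_or_gt w i).resolve_right hwi.not_gt
      have hup : IsReducedLift (a * σ i) (w * adjSwap i) :=
        IsReducedLift.mul_sigma (by rwa [mul_adjSwap_cancel]) (by simpa using hlt)
      have h1 := inv_mul_adjSwap_of_lt hlt
      have h2 := inv_le_card (w * adjSwap i)
      obtain ⟨c, hc⟩ := ih _ (by omega) hup rfl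
      exact ⟨σ i * c, by rw [hc, mul_assoc]⟩

theorem isReducedLift_of_leftDvd_delta {a : BraidMonoid n} (h : LeftDvd a (Δ n)) :
    IsReducedLift a (braidPerm n a) := by
  obtain ⟨c, hc⟩ := h
  have := isReducedLift_delta (n := n)
  rw [hc] at this
  exact this.of_mul

end BraidMonoid

/-- The canonical homomorphism `π : B_n⁺ → S_n`, sending `σ_i` to the transposition
`(i, i+1)`, restricts to a bijection from the set of left-divisors of `Δ_n` onto `S_n`. -/
theorem braidPerm_bijOn_divisors (n : ℕ) (hn : 1 ≤ n) :
    Set.BijOn (braidPerm n) { a : BraidMonoid n | LeftDvd a (Δ n) } Set.univ := by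
  refine ⟨fun _ _ => Set.mem_univ _, fun a ha b hb hab => ?_, fun w _ => ?_⟩
  · have hb' := BraidMonoid.isReducedLift_of_leftDvd_delta hb
    rw [← hab] at hb'
    exact (BraidMonoid.isReducedLift_of_leftDvd_delta ha).unique hb'
  · obtain ⟨a, ha⟩ := BraidMonoid.exists_isReducedLift w
    exact ⟨a, ha.leftDvd_delta, ha.perm_eq⟩
end

section
/- The braid group B_n is linear: there exist a positive integer m and an injective group homomorphism from B_n into the general linear group GL(m, ℝ) of invertible m × m real matrices. -/
/-- The braid relators in the free group over `Fin (n - 1)`: the index `i` stands for the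
Artin generator `σ_{i+1}` (indices are 0-based), and the relators express
`σ_i σ_j σ_i = σ_j σ_i σ_j` for `|i - j| = 1` and `σ_i σ_j = σ_j σ_i` for `|i - j| ≥ 2`. -/
def braidRelsGroup (n : ℕ) : Set (FreeGroup (Fin (n - 1))) :=
  { r | (∃ i j : Fin (n - 1), (i : ℕ) + 1 = (j : ℕ) ∧
          r = .of i * .of j * .of i * (.of j * .of i * .of j)⁻¹) ∨
        (∃ i j : Fin (n - 1), (i : ℕ) + 2 ≤ (j : ℕ) ∧
          r = .of i * .of j * (.of j * .of i)⁻¹) }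

/-- The braid group `B_n`, presented by the generators `σ_1, …, σ_{n-1}` and the
braid relations. -/
def BraidGroup (n : ℕ) := PresentedGroup (braidRelsGroup n)

instance (n : ℕ) : Group (BraidGroup n) :=
  inferInstanceAs (Group (PresentedGroup (braidRelsGroup n)))

/-- The generator `σ_{i+1}` of the braid group `B_n` (0-based index `i : Fin (n - 1)`). -/
def σG {n : ℕ} (i : Fin (n - 1)) : BraidGroup n := PresentedGroup.of i

/-- The Lawrence–Krammer operator of the `k`-th generator, acting on functions of a pair `i < j`
(and trivially on the remaining pairs), with parameters `q` and `t`. -/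
def lk {R : Type*} [CommRing R] (q t : R) (k : ℕ) (f : ℕ → ℕ → R) (i j : ℕ) : R :=
  if i = k ∧ j = k + 1 then t * q ^ 2 * f k (k + 1)
  else if i < k ∧ j = k then (1 - q) * f i k + q * f i (k + 1)
  else if i < k ∧ j = k + 1 then f i k + t * q * (q - 1) * f k (k + 1)
  else if i = k ∧ k + 1 < j then f (k + 1) j + t * q * (q - 1) * f k (k + 1)
  else if i = k + 1 ∧ k + 1 < j then q * f k j + (1 - q) * f (k + 1) j
  else if i < k ∧ k + 1 < j then f i j + t * (q - 1) ^ 2 * f k (k + 1)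
  else f i j

section
variable {R : Type*} [CommRing R] (q t : R) (k : ℕ) (f : ℕ → ℕ → R) {i j : ℕ}

theorem lk_simple (hi : i = k) (hj : j = k + 1) :
    lk q t k f i j = t * q ^ 2 * f k (k + 1) := by
  simp only [lk]; split_ifs <;> first | rfl | omega

theorem lk_left_low (hi : i < k) (hj : j = k) :
    lk q t k f i j = (1 - q) * f i k + q * f i (k + 1) := by
  simp only [lk]; split_ifs <;> first | rfl | omega

theorem lk_left_high (hi : i < k) (hj : j = k + 1) :
    lk q t k f i j = f i k + t * q * (q - 1) * f k (k + 1) := by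
  simp only [lk]; split_ifs <;> first | rfl | omega

theorem lk_right_low (hi : i = k) (hj : k + 1 < j) :
    lk q t k f i j = f (k + 1) j + t * q * (q - 1) * f k (k + 1) := by
  simp only [lk]; split_ifs <;> first | rfl | omega

theorem lk_right_high (hi : i = k + 1) (hj : k + 1 < j) :
    lk q t k f i j = q * f k j + (1 - q) * f (k + 1) j := by
  simp only [lk]; split_ifs <;> first | rfl | omega

theorem lk_outer (hi : i < k) (hj : k + 1 < j) :
    lk q t k f i j = f i j + t * (q - 1) ^ 2 * f k (k + 1) := by
  simp only [lk]; split_ifs <;> first | rfl | omega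

theorem lk_fixed (h : k + 1 < i ∨ j < k ∨ j ≤ i) : lk q t k f i j = f i j := by
  simp only [lk]; split_ifs <;> first | rfl | omega

theorem lk_braid :
    lk q t k (lk q t (k + 1) (lk q t k f)) = lk q t (k + 1) (lk q t k (lk q t (k + 1) f)) := by
  funext i j
  rcases (by omega : i < k ∨ i = k ∨ i = k + 1 ∨ i = k + 1 + 1 ∨ k + 1 + 1 < i) with
    hi | hi | hi | hi | hi <;>
  rcases (by omega : j < k ∨ j = k ∨ j = k + 1 ∨ j = k + 1 + 1 ∨ k + 1 + 1 < j) with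
    hj | hj | hj | hj | hj <;>
  (try subst i) <;> (try subst j) <;>
  simp (disch := omega) only [lk_simple, lk_left_low, lk_left_high, lk_right_low, lk_right_high,
    lk_outer, lk_fixed] <;> try ring

theorem lk_comm {k l : ℕ} (h : k + 2 ≤ l) : lk q t k (lk q t l f) = lk q t l (lk q t k f) := by
  funext i j
  rcases (by omega : i < k ∨ i = k ∨ i = k + 1 ∨ (k + 1 < i ∧ i < l) ∨ i = l ∨ i = l + 1 ∨
    l + 1 < i) with hi | hi | hi | hi | hi | hi | hi <;>
  rcases (by omega : j < k ∨ j = k ∨ j = k + 1 ∨ (k + 1 < j ∧ j < l) ∨ j = l ∨ j = l + 1 ∨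
    l + 1 < j) with hj | hj | hj | hj | hj | hj | hj <;>
  (try subst i) <;> (try subst j) <;>
  simp (disch := omega) only [lk_simple, lk_left_low, lk_left_high, lk_right_low, lk_right_high,
    lk_outer, lk_fixed] <;> try ring

theorem lk_add (g : ℕ → ℕ → R) : lk q t k (f + g) = lk q t k f + lk q t k g := by
  funext i j
  simp only [lk, Pi.add_apply]
  split_ifs <;> ring

theorem lk_smul (c : R) : lk q t k (c • f) = c • lk q t k f := by
  funext i j
  simp only [lk, Pi.smul_apply, smul_eq_mul]
  split_ifs <;> ring

theorem lk_congr {n : ℕ} {g : ℕ → ℕ → R} (hk : k + 1 < n)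
    (h : ∀ i < n, ∀ j < n, f i j = g i j) (hi : i < n) (hj : j < n) :
    lk q t k f i j = lk q t k g i j := by
  simp only [lk]
  split_ifs <;> simp (disch := omega) only [h]

theorem map_lk {S : Type*} [CommRing S] (φ : R →+* S) :
    φ (lk q t k f i j) = lk (φ q) (φ t) k (fun a b => φ (f a b)) i j := by
  simp only [lk]
  split_ifs <;> simp

/-- If `lk q t k f` vanishes on `[0, n) × [0, n)`, so does `f`. -/
theorem eq_zero_of_lk_eq_zero [IsDomain R] {n : ℕ} (hq : q ≠ 0) (ht : t ≠ 0) (hk : k + 1 < n)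
    (h : ∀ i < n, ∀ j < n, lk q t k f i j = 0) (hi : i < n) (hj : j < n) : f i j = 0 := by
  have h0 : f k (k + 1) = 0 := by
    have := h k (by omega) (k + 1) hk
    rw [lk_simple _ _ _ _ rfl rfl] at this
    simpa [hq, ht] using this
  have h1 : ∀ a < k, f a k = 0 := fun a ha => by
    have := h a (by omega) (k + 1) hk
    rw [lk_left_high _ _ _ _ ha rfl] at this
    simpa [h0] using this
  have h2 : ∀ b < n, k + 1 < b → f (k + 1) b = 0 := fun b hb hkb => by
    have := h k (by omega) b hb
    rw [lk_right_low _ _ _ _ rfl hkb] at this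
    simpa [h0] using this
  have := h i hi j hj
  simp only [lk] at this
  split_ifs at this with c1 c2 c3 c4 c5 c6
  · rw [c1.1, c1.2, h0]
  · rw [c2.2, h1 i c2.1]
  · have := h i hi k (by omega)
    rw [lk_left_low _ _ _ _ c3.1 rfl, h1 i c3.1] at this
    rw [c3.2]
    simpa [hq] using this
  · have := h (k + 1) hk j hj
    rw [lk_right_high _ _ _ _ rfl c4.2, h2 j hj c4.2] at this
    rw [c4.1]
    simpa [hq] using this
  · rw [c5.1, h2 j hj c5.2]
  · simpa [h0] using this
  · exact this
end

/-- The action of a positive word, the composite of the operators `lk` of its letters. -/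
def lkWord {R : Type*} [CommRing R] (q t : R) (w : List ℕ) (f : ℕ → ℕ → R) : ℕ → ℕ → R :=
  w.foldr (lk q t) f

theorem map_lkWord {R S : Type*} [CommRing R] [CommRing S] (φ : R →+* S) (q t : R) (w : List ℕ)
    (f : ℕ → ℕ → R) (i j : ℕ) :
    φ (lkWord q t w f i j) = lkWord (φ q) (φ t) w (fun a b => φ (f a b)) i j := by
  induction w generalizing i j with
  | nil => rfl
  | cons k w ih =>
    simp only [lkWord, List.foldr_cons] at ih ⊢
    rw [map_lk]
    congr 1
    funext a b
    exact ih a b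

theorem lk_nonneg {R : Type*} [Field R] [LinearOrder R] [IsStrictOrderedRing R] (k : ℕ)
    {f : ℕ → ℕ → R} (hf : ∀ i j, 0 ≤ f i j) (i j : ℕ) : 0 ≤ lk (1 / 2) 0 k f i j := by
  simp only [lk]
  split_ifs
  · simp
  · norm_num
    linarith [hf i k, hf i (k + 1)]
  · simp [hf]
  · simp [hf]
  · norm_num
    linarith [hf k j, hf (k + 1) j]
  · simp [hf]
  · exact hf i j

theorem lkWord_nonneg {R : Type*} [Field R] [LinearOrder R] [IsStrictOrderedRing R] (w : List ℕ)
    {f : ℕ → ℕ → R} (hf : ∀ i j, 0 ≤ f i j) (i j : ℕ) : 0 ≤ lkWord (1 / 2) 0 w f i j := by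
  induction w generalizing i j with
  | nil => exact hf i j
  | cons k w ih => exact lk_nonneg k ih i j

section
variable {G : Type*} [Group G] {s : ℕ → G}

/-- The product `s 0 * s 1 * ⋯ * s (m - 1)`. -/
def coxeterProd (s : ℕ → G) (m : ℕ) : G := ((List.range m).map s).prod

theorem coxeterProd_succ (s : ℕ → G) (m : ℕ) :
    coxeterProd s (m + 1) = coxeterProd s m * s m := by
  simp [coxeterProd, List.range_succ]

theorem coxeterProd_succ' (s : ℕ → G) (m : ℕ) :
    coxeterProd s (m + 1) = s 0 * coxeterProd (fun i => s (i + 1)) m := by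
  simp [coxeterProd, List.range_succ_eq_map, Function.comp_def]

theorem coxeterProd_mul {N : ℕ}
    (hb : ∀ i, i + 1 < N → s i * s (i + 1) * s i = s (i + 1) * s i * s (i + 1))
    (hc : ∀ i j, i + 2 ≤ j → j < N → s i * s j = s j * s i) {m i : ℕ} (hm : m ≤ N)
    (hi : i + 1 < m) : coxeterProd s m * s i = s (i + 1) * coxeterProd s m := by
  have comm : ∀ l j, l < j → j < N → Commute (coxeterProd s l) (s j) := by
    intro l j hl hj
    refine Commute.list_prod_left _ _ fun x hx => ?_
    obtain ⟨a, ha, rfl⟩ := List.mem_map.1 hx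
    exact hc a j (by have := List.mem_range.1 ha; omega) hj
  induction m with
  | zero => omega
  | succ m ih =>
    rcases Nat.lt_or_ge (i + 1) m with h | h
    · rw [coxeterProd_succ, mul_assoc, ← hc i m (by omega) (by omega), ← mul_assoc,
        ih (by omega) h, mul_assoc]
    · obtain rfl : m = i + 1 := by omega
      rw [coxeterProd_succ, coxeterProd_succ]
      calc _ = coxeterProd s i * (s i * s (i + 1) * s i) := by group
        _ = (coxeterProd s i * s (i + 1)) * s i * s (i + 1) := by rw [hb i (by omega)]; group
        _ = _ := by rw [(comm i (i + 1) (by omega) (by omega)).eq]; group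

/-- In a group whose generators satisfy the braid relations, every element is a left fraction of
positive elements. -/
theorem exists_mul_mem_closure {N : ℕ}
    (hb : ∀ i, i + 1 < N → s i * s (i + 1) * s i = s (i + 1) * s i * s (i + 1))
    (hc : ∀ i j, i + 2 ≤ j → j < N → s i * s j = s j * s i) {g : G}
    (hg : g ∈ Subgroup.closure (s '' Set.Iio N)) :
    ∃ p ∈ Submonoid.closure (s '' Set.Iio N), p * g ∈ Submonoid.closure (s '' Set.Iio N) := by
  obtain _ | M := N
  · refine ⟨1, one_mem _, ?_⟩
    simp_all
  set P := Submonoid.closure (s '' Set.Iio (M + 1)) with hP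
  set d := coxeterProd s (M + 1) with hd
  have hs : ∀ i ≤ M, s i ∈ P := fun i hi =>
    Submonoid.subset_closure ⟨i, Nat.lt_succ_of_le hi, rfl⟩
  have hprod : ∀ m ≤ M + 1, coxeterProd s m ∈ P := fun m hm => by
    refine Submonoid.list_prod_mem _ fun x hx => ?_
    obtain ⟨a, ha, rfl⟩ := List.mem_map.1 hx
    exact hs a (by have := List.mem_range.1 ha; omega)
  have hdP : d ∈ P := hprod _ le_rfl
  have shift : ∀ i < M, d * s i = s (i + 1) * d := fun i hi =>
    coxeterProd_mul hb hc le_rfl (by omega)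
  have shiftProd : ∀ m ≤ M, d * coxeterProd s m = coxeterProd (fun i => s (i + 1)) m * d := by
    intro m hm
    induction m with
    | zero => simp [coxeterProd]
    | succ m ih =>
      rw [coxeterProd_succ, coxeterProd_succ, ← mul_assoc, ih (by omega), mul_assoc,
        shift m (by omega), mul_assoc]
  have wrap : d ^ 2 * s M = s 0 * d ^ 2 := by
    have h1 : d = coxeterProd s M * s M := coxeterProd_succ s M
    have h2 : d = s 0 * coxeterProd (fun i => s (i + 1)) M := coxeterProd_succ' s M
    calc d ^ 2 * s M = d * d * s M := by rw [pow_two]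
      _ = s 0 * coxeterProd (fun i => s (i + 1)) M * d * s M := by rw [← h2]
      _ = s 0 * (d * coxeterProd s M) * s M := by rw [shiftProd M le_rfl]; group
      _ = s 0 * d * (coxeterProd s M * s M) := by group
      _ = s 0 * d ^ 2 := by rw [← h1, pow_two, mul_assoc]
  have shiftPow : ∀ i ≤ M, d ^ i * s 0 = s i * d ^ i := by
    intro i hi
    induction i with
    | zero => simp
    | succ i ih => rw [pow_succ', mul_assoc, ih (by omega), ← mul_assoc, shift i (by omega),
        mul_assoc]
  set z := d ^ (M + 2) with hz
  have hzd : Commute z d := (Commute.refl d).pow_left _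
  have hzs : ∀ i ≤ M, Commute z (s i) := by
    have h0 : Commute z (s 0) := by
      change d ^ (M + 2) * s 0 = s 0 * d ^ (M + 2)
      rw [add_comm, pow_add, mul_assoc, shiftPow M le_rfl, ← mul_assoc, wrap, mul_assoc]
    intro i hi
    rw [eq_mul_inv_of_mul_eq (shiftPow i hi).symm]
    exact ((hzd.pow_right i).mul_right h0).mul_right (hzd.pow_right i).inv_right
  let S : Submonoid G :=
    { carrier := {g | Commute z g ∧ ∃ k : ℕ, z ^ k * g ∈ P}
      one_mem' := ⟨Commute.one_right z, 0, by simp⟩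
      mul_mem' := by
        rintro a b ⟨ha, k, hk⟩ ⟨hb, l, hl⟩
        refine ⟨ha.mul_right hb, k + l, ?_⟩
        have : z ^ (k + l) * (a * b) = z ^ k * a * (z ^ l * b) := by
          rw [pow_add, mul_assoc, mul_assoc, ← mul_assoc (z ^ l), (ha.pow_left l).eq, mul_assoc]
        exact this ▸ mul_mem hk hl }
  have hsS : ∀ i ≤ M, s i ∈ S := fun i hi => ⟨hzs i hi, 0, by simpa using hs i hi⟩
  have hdS : d ∈ S := ⟨hzd, 0, by simpa using hdP⟩
  have hdS' : d⁻¹ ∈ S := by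
    refine ⟨hzd.inv_right, 1, ?_⟩
    rw [pow_one, hz, pow_succ, mul_inv_cancel_right]
    exact pow_mem hdP _
  have hinv : ∀ e i, i + e = M → (s i)⁻¹ ∈ S := by
    intro e
    induction e with
    | zero =>
      rintro i rfl
      have h1 : (s (i + 0))⁻¹ = d⁻¹ * coxeterProd s (i + 0) := by
        rw [hd, coxeterProd_succ]; group
      rw [add_zero] at *
      rw [h1]
      refine mul_mem hdS' ⟨?_, 0, by simpa using hprod i (by omega)⟩
      refine Commute.list_prod_right _ _ fun x hx => ?_
      obtain ⟨a, ha, rfl⟩ := List.mem_map.1 hx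
      exact hzs a (by have := List.mem_range.1 ha; omega)
    | succ e ih =>
      intro i hi
      have h1 : (s i)⁻¹ = d⁻¹ * (s (i + 1))⁻¹ * d := by
        rw [← mul_right_inj (d), ← mul_left_inj (s i), mul_assoc _ _ (s i), mul_assoc _ _ (s i)]
        rw [mul_assoc _ d, shift i (by omega)]
        group
      rw [h1]
      exact mul_mem (mul_mem hdS' (ih _ (by omega))) hdS
  have hgS : g ∈ S := by
    rw [← Subgroup.mem_toSubmonoid, Subgroup.closure_toSubmonoid] at hg
    refine Submonoid.closure_le.2 ?_ hg
    rintro x (⟨i, hi, rfl⟩ | hx)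
    · exact hsS i (Nat.le_of_lt_succ hi)
    · obtain ⟨i, hi, h⟩ := Set.mem_inv.1 hx
      rw [← inv_inv x, ← h]
      have hi : i < M + 1 := hi
      exact hinv (M - i) i (by omega)
  obtain ⟨-, k, hk⟩ := hgS
  exact ⟨z ^ k, pow_mem (pow_mem hdP _) _, hk⟩

end

section
variable {n : ℕ}

/-- Extension by zero of a function on `Fin n × Fin n`. -/
def zeroExtend (n : ℕ) (f : Fin n → Fin n → ℝ) (i j : ℕ) : ℝ :=
  if h : i < n ∧ j < n then f ⟨i, h.1⟩ ⟨j, h.2⟩ else 0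

theorem zeroExtend_apply (f : Fin n → Fin n → ℝ) (i j : Fin n) :
    zeroExtend n f i j = f i j := by simp [zeroExtend]

/-- The action of the `k`-th generator on functions on `Fin n × Fin n`. -/
def lkEnd (n : ℕ) (q t : ℝ) (k : ℕ) : Module.End ℝ (Fin n → Fin n → ℝ) where
  toFun f i j := lk q t k (zeroExtend n f) i j
  map_add' f g := by
    have : zeroExtend n (f + g) = zeroExtend n f + zeroExtend n g := by
      funext i j
      simp only [zeroExtend, Pi.add_apply]
      split_ifs <;> simp
    funext i j
    rw [this, lk_add]
    rfl
  map_smul' c f := by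
    have : zeroExtend n (c • f) = c • zeroExtend n f := by
      funext i j
      simp only [zeroExtend, Pi.smul_apply]
      split_ifs <;> simp
    funext i j
    rw [this, lk_smul]
    rfl

theorem zeroExtend_lkEnd (q t : ℝ) (k : ℕ) (f : Fin n → Fin n → ℝ) {i j : ℕ}
    (hi : i < n) (hj : j < n) :
    zeroExtend n (lkEnd n q t k f) i j = lk q t k (zeroExtend n f) i j := by
  simp [zeroExtend, lkEnd, hi, hj]

theorem lkEnd_injective {q t : ℝ} (hq : q ≠ 0) (ht : t ≠ 0) {k : ℕ} (hk : k + 1 < n) :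
    Function.Injective (lkEnd n q t k) := by
  refine (injective_iff_map_eq_zero _).2 fun f hf => ?_
  funext i j
  rw [← zeroExtend_apply f i j]
  refine eq_zero_of_lk_eq_zero q t k _ hq ht hk (fun a ha b hb => ?_) i.2 j.2
  exact congr_fun (congr_fun hf ⟨a, ha⟩) ⟨b, hb⟩

theorem lkEnd_braid (q t : ℝ) {k : ℕ} (hk : k + 2 < n) :
    lkEnd n q t k * lkEnd n q t (k + 1) * lkEnd n q t k =
      lkEnd n q t (k + 1) * lkEnd n q t k * lkEnd n q t (k + 1) := by
  refine LinearMap.ext fun f => ?_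
  funext i j
  have key : ∀ a b c : ℕ, a + 1 < n → b + 1 < n →
      (lkEnd n q t a * lkEnd n q t b * lkEnd n q t c) f i j =
        lk q t a (lk q t b (lk q t c (zeroExtend n f))) i j := fun a b c ha hb =>
    lk_congr _ _ _ _ ha (fun x hx y hy => (zeroExtend_lkEnd _ _ _ _ hx hy).trans
      (lk_congr _ _ _ _ hb (fun _ hx _ hy => zeroExtend_lkEnd _ _ _ _ hx hy) hx hy)) i.2 j.2
  rw [key _ _ _ (by omega) (by omega), key _ _ _ (by omega) (by omega), lk_braid]

theorem lkEnd_comm (q t : ℝ) {k l : ℕ} (hkl : k + 2 ≤ l) (hl : l + 1 < n) :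
    lkEnd n q t k * lkEnd n q t l = lkEnd n q t l * lkEnd n q t k := by
  refine LinearMap.ext fun f => ?_
  funext i j
  have key : ∀ a b : ℕ, a + 1 < n → (lkEnd n q t a * lkEnd n q t b) f i j =
        lk q t a (lk q t b (zeroExtend n f)) i j := fun a b ha =>
    lk_congr _ _ _ _ ha (fun _ hx _ hy => zeroExtend_lkEnd _ _ _ _ hx hy) i.2 j.2
  rw [key _ _ (by omega), key _ _ (by omega), lk_comm _ _ _ hkl]

/-- The `k`-th generator as an invertible operator. -/
noncomputable def lkUnit (n : ℕ) {q t : ℝ} (hq : q ≠ 0) (ht : t ≠ 0) (k : Fin (n - 1)) :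
    (Module.End ℝ (Fin n → Fin n → ℝ))ˣ :=
  LinearMap.GeneralLinearGroup.ofLinearEquiv
    (LinearEquiv.ofInjectiveEndo (lkEnd n q t k) (lkEnd_injective hq ht (by omega)))

theorem coe_lkUnit {q t : ℝ} (hq : q ≠ 0) (ht : t ≠ 0) (k : Fin (n - 1)) :
    (lkUnit n hq ht k : Module.End ℝ (Fin n → Fin n → ℝ)) = lkEnd n q t k := rfl

theorem lift_lkUnit_eq_one {q t : ℝ} (hq : q ≠ 0) (ht : t ≠ 0) :
    ∀ r ∈ braidRelsGroup n, FreeGroup.lift (lkUnit n hq ht) r = 1 := by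
  rintro r (⟨i, j, hij, rfl⟩ | ⟨i, j, hij, rfl⟩)
  · simp only [map_mul, map_inv, FreeGroup.lift_apply_of, mul_inv_eq_one]
    refine Units.ext ?_
    simp only [Units.val_mul, coe_lkUnit, ← hij]
    exact lkEnd_braid q t (by omega)
  · simp only [map_mul, map_inv, FreeGroup.lift_apply_of, mul_inv_eq_one]
    refine Units.ext ?_
    simp only [Units.val_mul, coe_lkUnit]
    exact lkEnd_comm q t hij (by omega)

/-- The Lawrence–Krammer representation of the braid group. -/
noncomputable def lkRep (n : ℕ) {q t : ℝ} (hq : q ≠ 0) (ht : t ≠ 0) :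
    BraidGroup n →* (Module.End ℝ (Fin n → Fin n → ℝ))ˣ :=
  PresentedGroup.toGroup (lift_lkUnit_eq_one hq ht)

theorem lkRep_σG {q t : ℝ} (hq : q ≠ 0) (ht : t ≠ 0) (k : Fin (n - 1)) :
    lkRep n hq ht (σG k) = lkUnit n hq ht k :=
  PresentedGroup.toGroup.of (lift_lkUnit_eq_one hq ht)

theorem σG_braid {i j : Fin (n - 1)} (h : (i : ℕ) + 1 = j) :
    (σG i * σG j * σG i : BraidGroup n) = σG j * σG i * σG j :=
  mul_inv_eq_one.1 (PresentedGroup.one_of_mem (rels := braidRelsGroup n) (Or.inl ⟨i, j, h, rfl⟩))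

theorem σG_comm {i j : Fin (n - 1)} (h : (i : ℕ) + 2 ≤ j) :
    (σG i * σG j : BraidGroup n) = σG j * σG i :=
  mul_inv_eq_one.1 (PresentedGroup.one_of_mem (rels := braidRelsGroup n) (Or.inr ⟨i, j, h, rfl⟩))

/-- The positive braid represented by a word in the generators. -/
def positiveBraid (w : List (Fin (n - 1))) : BraidGroup n := (w.map σG).prod

theorem positiveBraid_cons (k : Fin (n - 1)) (w : List (Fin (n - 1))) :
    positiveBraid (k :: w) = σG k * positiveBraid w := by simp [positiveBraid]

/-- The word action on the indicator function of the square `[0, n) × [0, n)`. -/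
def lkVector {R : Type*} [CommRing R] (q t : R) (w : List (Fin (n - 1))) : ℕ → ℕ → R :=
  lkWord q t (w.map Fin.val) fun i j => if i < n ∧ j < n then 1 else 0

theorem lkVector_cons {R : Type*} [CommRing R] (q t : R) (k : Fin (n - 1))
    (w : List (Fin (n - 1))) : lkVector q t (k :: w) = lk q t k (lkVector q t w) := rfl

theorem map_lkVector {R S : Type*} [CommRing R] [CommRing S] (φ : R →+* S) (q t : R)
    (w : List (Fin (n - 1))) (i j : ℕ) :
    φ (lkVector q t w i j) = lkVector (φ q) (φ t) w i j := by
  rw [lkVector, map_lkWord, lkVector]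
  congr 1
  funext a b
  split_ifs <;> simp

theorem lkRep_positiveBraid {q t : ℝ} (hq : q ≠ 0) (ht : t ≠ 0) (w : List (Fin (n - 1)))
    {i j : ℕ} (hi : i < n) (hj : j < n) :
    zeroExtend n ((lkRep n hq ht (positiveBraid w) : Module.End ℝ (Fin n → Fin n → ℝ))
      fun _ _ => 1) i j = lkVector q t w i j := by
  induction w generalizing i j with
  | nil => simp [positiveBraid, zeroExtend, lkVector, lkWord, hi, hj]
  | cons k w ih =>
    rw [positiveBraid_cons, map_mul, lkRep_σG, Units.val_mul, coe_lkUnit, Module.End.mul_apply,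
      zeroExtend_lkEnd _ _ _ _ hi hj, lkVector_cons]
    exact lk_congr _ _ _ _ (by omega) (fun _ hx _ hy => ih hx hy) hi hj

theorem lkVector_eq_of_lkRep_eq {t : ℝ} (hq : (1 / 2 : ℝ) ≠ 0) (ht : t ≠ 0)
    (htr : Transcendental ℚ t) {a b : List (Fin (n - 1))}
    (h : lkRep n hq ht (positiveBraid a) = lkRep n hq ht (positiveBraid b))
    {i j : ℕ} (hi : i < n) (hj : j < n) :
    lkVector (1 / 2 : ℚ) 0 a i j = lkVector (1 / 2 : ℚ) 0 b i j := by
  have h1 : lkVector (1 / 2 : ℝ) t a i j = lkVector (1 / 2 : ℝ) t b i j := by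
    rw [← lkRep_positiveBraid hq ht a hi hj, ← lkRep_positiveBraid hq ht b hi hj, h]
  have h2 : ∀ w : List (Fin (n - 1)), Polynomial.aeval t
      (lkVector (Polynomial.C (1 / 2 : ℚ)) Polynomial.X w i j) = lkVector (1 / 2 : ℝ) t w i j := by
    intro w
    have := map_lkVector (Polynomial.aeval (R := ℚ) t).toRingHom
      (Polynomial.C (1 / 2 : ℚ)) Polynomial.X w i j
    simpa using this
  have h3 := transcendental_iff_injective.1 htr ((h2 a).trans (h1.trans (h2 b).symm))
  have h4 := congr_arg (Polynomial.evalRingHom (0 : ℚ)) h3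
  rw [map_lkVector, map_lkVector] at h4
  simpa using h4

theorem lkVector_nonneg (w : List (Fin (n - 1))) (i j : ℕ) :
    0 ≤ lkVector (1 / 2 : ℚ) 0 w i j :=
  lkWord_nonneg _ (fun i j => by split_ifs <;> simp) i j

/-- Specialised to `t = 0`, the Lawrence–Krammer action detects left divisibility of a positive
braid by a generator. -/
theorem exists_positiveBraid_eq_σG_mul {t : ℝ} (hq : (1 / 2 : ℝ) ≠ 0) (ht : t ≠ 0)
    (htr : Transcendental ℚ t) (w : List (Fin (n - 1))) (k : Fin (n - 1))
    (h : lkVector (1 / 2 : ℚ) 0 w k (k + 1) = 0) :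
    ∃ v : List (Fin (n - 1)), v.length + 1 = w.length ∧
      positiveBraid w = σG k * positiveBraid v := by
  induction hl : w.length using Nat.strong_induction_on generalizing w k with
  | _ l ih =>
  subst hl
  obtain _ | ⟨j, c⟩ := w
  · have h1 : (k : ℕ) < n ∧ (k : ℕ) + 1 < n := by omega
    simp [lkVector, lkWord, h1] at h
  have hpos := lkVector_nonneg c
  have heq : ∀ {d}, positiveBraid c = σG k * positiveBraid d → ∀ {x y : ℕ}, x < n → y < n →
      lkVector (1 / 2 : ℚ) 0 c x y = lk (1 / 2 : ℚ) 0 k (lkVector (1 / 2 : ℚ) 0 d) x y := by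
    intro d hd x y hx hy
    rw [← lkVector_cons]
    exact lkVector_eq_of_lkRep_eq hq ht htr (by rw [hd, positiveBraid_cons]) hx hy
  rw [lkVector_cons] at h
  simp only [positiveBraid_cons, List.length_cons]
  rcases (by omega : (k : ℕ) = j ∨ (j : ℕ) + 1 = k ∨ (k : ℕ) + 1 = j ∨ (j : ℕ) + 2 ≤ k ∨
    (k : ℕ) + 2 ≤ j) with hjk | hjk | hjk | hjk
  · obtain rfl := Fin.ext hjk
    exact ⟨c, rfl, rfl⟩
  · rw [lk_right_high _ _ _ _ hjk.symm (by omega), hjk] at h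
    have h1 := hpos j (k + 1)
    have h2 := hpos k (k + 1)
    norm_num at h h1 h2
    obtain ⟨d, hdl, hd⟩ := ih _ (Nat.lt_succ_self _) c k (by norm_num; linarith) rfl
    have h3 := heq hd (x := j) (y := k + 1) (by omega) (by omega)
    rw [lk_left_high _ _ _ _ (by omega) rfl, ← hjk] at h3
    obtain ⟨e, hel, he⟩ := ih d.length (by simp; omega) d j (by
      norm_num at h3 ⊢
      rw [← hjk] at h h1 h2
      linarith) rfl
    refine ⟨j :: k :: e, by simp; omega, ?_⟩
    rw [hd, he, positiveBraid_cons, positiveBraid_cons]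
    simp only [← mul_assoc]
    rw [σG_braid hjk]
  · rw [lk_left_low _ _ _ _ (by omega) hjk] at h
    have h1 := hpos k j
    have h2 := hpos k (j + 1)
    norm_num at h h1 h2
    obtain ⟨d, hdl, hd⟩ := ih _ (Nat.lt_succ_self _) c k (by rw [hjk]; norm_num; linarith) rfl
    have h3 := heq hd (x := k) (y := j + 1) (by omega) (by omega)
    rw [lk_right_low _ _ _ _ rfl (by omega), hjk] at h3
    obtain ⟨e, hel, he⟩ := ih d.length (by simp; omega) d j (by
      norm_num at h3 ⊢
      linarith) rfl
    refine ⟨j :: k :: e, by simp; omega, ?_⟩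
    rw [hd, he, positiveBraid_cons, positiveBraid_cons]
    simp only [← mul_assoc]
    rw [σG_braid hjk]
  · have hcomm : (σG j * σG k : BraidGroup n) = σG k * σG j :=
      hjk.elim (fun h => σG_comm h) fun h => (σG_comm h).symm
    rw [lk_fixed _ _ _ _ (by omega)] at h
    obtain ⟨d, hdl, hd⟩ := ih _ (Nat.lt_succ_self _) c k h rfl
    refine ⟨j :: d, by simpa using hdl, ?_⟩
    rw [hd, positiveBraid_cons, ← mul_assoc, hcomm, mul_assoc]

theorem lkVector_cons_self (k : Fin (n - 1)) (w : List (Fin (n - 1))) :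
    lkVector (1 / 2 : ℚ) 0 (k :: w) k (k + 1) = 0 := by
  rw [lkVector_cons, lk_simple _ _ _ _ rfl rfl]
  simp

theorem positiveBraid_eq_of_lkRep_eq {t : ℝ} (hq : (1 / 2 : ℝ) ≠ 0) (ht : t ≠ 0)
    (htr : Transcendental ℚ t) (a b : List (Fin (n - 1)))
    (h : lkRep n hq ht (positiveBraid a) = lkRep n hq ht (positiveBraid b)) :
    positiveBraid a = positiveBraid b := by
  have step : ∀ (k : Fin (n - 1)) (c d : List (Fin (n - 1))),
      lkRep n hq ht (positiveBraid (k :: c)) = lkRep n hq ht (positiveBraid d) →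
      ∃ v : List (Fin (n - 1)), v.length + 1 = d.length ∧
        positiveBraid d = σG k * positiveBraid v := fun k c d hcd =>
    exists_positiveBraid_eq_σG_mul hq ht htr d k <|
      (lkVector_eq_of_lkRep_eq hq ht htr hcd (by omega) (by omega)).symm.trans
        (lkVector_cons_self k c)
  induction a generalizing b with
  | nil =>
    obtain _ | ⟨k, c⟩ := b
    · rfl
    · obtain ⟨v, hv, -⟩ := step k c [] h.symm
      simp at hv
  | cons k c ih =>
    obtain ⟨v, -, hv⟩ := step k c b h
    rw [positiveBraid_cons, hv, map_mul, map_mul, mul_right_inj] at h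
    rw [positiveBraid_cons, hv, ih v h]

theorem exists_positiveBraid_mul_eq (g : BraidGroup n) :
    ∃ a b : List (Fin (n - 1)), positiveBraid a * g = positiveBraid b := by
  let s : ℕ → BraidGroup n := fun i => if h : i < n - 1 then σG ⟨i, h⟩ else 1
  have hs : ∀ i (h : i < n - 1), s i = σG ⟨i, h⟩ := fun i h => dif_pos h
  have himg : s '' Set.Iio (n - 1) = Set.range (σG (n := n)) := by
    ext x
    constructor
    · rintro ⟨i, hi, rfl⟩
      exact ⟨⟨i, hi⟩, (hs i hi).symm⟩
    · rintro ⟨i, rfl⟩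
      exact ⟨i, i.2, hs i i.2⟩
  have hg : g ∈ Subgroup.closure (s '' Set.Iio (n - 1)) := by
    have : Subgroup.closure (Set.range (σG (n := n))) = ⊤ :=
      PresentedGroup.closure_range_of (braidRelsGroup n)
    rw [himg, this]
    trivial
  have hword : ∀ x ∈ Submonoid.closure (s '' Set.Iio (n - 1)),
      ∃ w : List (Fin (n - 1)), positiveBraid w = x := by
    intro x hx
    rw [himg] at hx
    induction hx using Submonoid.closure_induction with
    | mem x hx =>
      obtain ⟨i, rfl⟩ := hx
      exact ⟨[i], by simp [positiveBraid]⟩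
    | one => exact ⟨[], by simp [positiveBraid]⟩
    | mul x y _ _ hx hy =>
      obtain ⟨v, rfl⟩ := hx
      obtain ⟨w, rfl⟩ := hy
      exact ⟨v ++ w, by simp [positiveBraid]⟩
  obtain ⟨p, hp, hpg⟩ := exists_mul_mem_closure (s := s) (N := n - 1)
    (fun i hi => by
      rw [hs i (by omega), hs (i + 1) hi]
      exact σG_braid rfl)
    (fun i j hij hj => by
      rw [hs i (by omega), hs j hj]
      exact σG_comm hij) hg
  obtain ⟨a, rfl⟩ := hword p hp
  obtain ⟨b, hb⟩ := hword _ hpg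
  exact ⟨a, b, hb.symm⟩

theorem lkRep_injective {t : ℝ} (hq : (1 / 2 : ℝ) ≠ 0) (ht : t ≠ 0) (htr : Transcendental ℚ t) :
    Function.Injective (lkRep n hq ht) := by
  refine (injective_iff_map_eq_one _).2 fun g hg => ?_
  obtain ⟨a, b, hab⟩ := exists_positiveBraid_mul_eq g
  have := positiveBraid_eq_of_lkRep_eq hq ht htr a b (by rw [← hab, map_mul, hg, mul_one])
  rw [← this] at hab
  simpa using hab

end

theorem exists_transcendental_rat_real : ∃ t : ℝ, Transcendental ℚ t := by
  refine ⟨liouvilleNumber 2, fun h => ?_⟩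
  exact transcendental_liouvilleNumber (m := 2) le_rfl ((IsFractionRing.isAlgebraic_iff ℤ ℚ ℝ).2 h)

/-- The braid group `B_n` is linear: it embeds into `GL(m, ℝ)` for some `m ≥ 1`. -/
theorem braidGroup_linear (n : ℕ) (hn : 1 ≤ n) :
    ∃ m : ℕ, 0 < m ∧
      ∃ φ : BraidGroup n →* Matrix.GeneralLinearGroup (Fin m) ℝ, Function.Injective φ := by
  obtain ⟨t, htr⟩ := exists_transcendental_rat_real
  have hq : (1 / 2 : ℝ) ≠ 0 := by norm_num
  have ht : t ≠ 0 := by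
    rintro rfl
    exact htr isAlgebraic_zero
  have : Nonempty (Fin n) := ⟨⟨0, hn⟩⟩
  refine ⟨Module.finrank ℝ (Fin n → Fin n → ℝ), Module.finrank_pos,
    (Units.mapEquiv (LinearMap.toMatrixAlgEquiv
      (Module.finBasis ℝ (Fin n → Fin n → ℝ))).toMulEquiv).toMonoidHom.comp
      (lkRep n hq ht), ?_⟩
  exact (Units.mapEquiv _).injective.comp (lkRep_injective hq ht htr)
end

section
/- For every Coxeter matrix M on a finite index set whose associated Coxeter group is finite, the Artin–Tits monoid A^+(M) is both left-cancellative and right-cancellative. -/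
open CoxeterSystem in
/-- The Artin–Tits relations associated with a Coxeter matrix `M`: for each pair `a ≠ b`
with `M a b` finite (Mathlib's convention: `M a b = 0` encodes `∞`), the two alternating
products `s_a s_b s_a ⋯` and `s_b s_a s_b ⋯` of length `M a b` are equated. -/
def artinTitsRels {B : Type*} (M : CoxeterMatrix B) :
    FreeMonoid B → FreeMonoid B → Prop := fun x y =>
  ∃ a b : B, a ≠ b ∧ M a b ≠ 0 ∧
    x = FreeMonoid.ofList (alternatingWord a b (M a b)) ∧
    y = FreeMonoid.ofList (alternatingWord b a (M a b))

/-- The Artin–Tits monoid `A⁺(M)` of a Coxeter matrix `M`. -/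
def ArtinTitsMonoid {B : Type*} (M : CoxeterMatrix B) := PresentedMonoid (artinTitsRels M)

instance {B : Type*} (M : CoxeterMatrix B) : Monoid (ArtinTitsMonoid M) :=
  inferInstanceAs (Monoid (PresentedMonoid (artinTitsRels M)))

namespace CoxeterMatrix

open Module Polynomial.Chebyshev

variable {B : Type*} [Finite B] (M : CoxeterMatrix B)

/-- The doubled Tits form: the functional `v ↦ 2⟨e_i, v⟩` on `B → ℝ`, where
`⟨e_i, e_j⟩ = -cos (π / M i j)`. -/
noncomputable def titsForm (i : B) : Dual ℝ (B → ℝ) :=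
  letI := Fintype.ofFinite B
  ∑ j, (-2 * Real.cos (Real.pi / M i j)) • LinearMap.proj j

open Classical in
theorem titsForm_single (i j : B) :
    M.titsForm i (Pi.single j 1) = -2 * Real.cos (Real.pi / M i j) := by
  simp [titsForm, Pi.single_apply]

open Classical in
theorem titsForm_single_self (i : B) : M.titsForm i (Pi.single i 1) = 2 := by
  simp [titsForm_single]

open Classical in
/-- The reflections generating the geometric representation of a Coxeter group. -/
noncomputable def geomReflection (i : B) : (B → ℝ) ≃ₗ[ℝ] (B → ℝ) :=
  reflection (M.titsForm_single_self i)

open Classical in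
theorem titsForm_mul_titsForm_sub_two (i j : B) :
    M.titsForm i (Pi.single j 1) * M.titsForm j (Pi.single i 1) - 2 =
      2 * Real.cos (2 * Real.pi / M i j) := by
  rw [titsForm_single, titsForm_single, M.symmetric j i, mul_div_assoc, Real.cos_two_mul]
  ring

theorem isLiftable_geomReflection : M.IsLiftable M.geomReflection := by
  classical
  intro i j
  obtain rfl | hij := eq_or_ne i j
  · ext1 v
    simp [geomReflection, involutive_reflection (M.titsForm_single_self i) v]
  have h1 := M.off_diagonal i j hij
  obtain h0 | h0 := eq_or_ne (M i j) 0
  · simp [h0]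
  ext1 v
  have key := reflection_mul_reflection_pow_apply (M.titsForm_single_self i)
    (M.titsForm_single_self j) (M i j) v _ (M.titsForm_mul_titsForm_sub_two i j).symm
  change ((M.geomReflection i * M.geomReflection j) ^ _) _ = _ at key
  rw [key, LinearEquiv.coe_one, id]
  obtain h2 | h2 := eq_or_ne (M i j) 2
  · have hf : M.titsForm i (Pi.single j 1) = 0 := by simp [titsForm_single, h2]
    have hg : M.titsForm j (Pi.single i 1) = 0 := by
      have := M.symmetric j i
      simp [titsForm_single, this, h2]
    rw [hf, hg, h2]
    norm_num
    module
  have h3 : 3 ≤ M i j := by grind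
  set m := M i j with hm
  set θ := 2 * Real.pi / m with hθ
  have hm0 : (m : ℝ) ≠ 0 := by positivity
  have hmθ : m * θ = 2 * Real.pi := by rw [hθ]; field_simp
  have hsin : Real.sin θ ≠ 0 := by
    apply ne_of_gt
    apply Real.sin_pos_of_pos_of_lt_pi
    · rw [hθ]; positivity
    · have : (3 : ℝ) ≤ m := by exact_mod_cast h3
      rw [hθ, div_lt_iff₀ (by positivity)]
      nlinarith [Real.pi_pos]
  have e (n : ℤ) : (S ℝ n).eval (2 * Real.cos θ) = Real.sin ((n + 1) * θ) / Real.sin θ := by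
    rw [eq_div_iff hsin]
    exact S_two_mul_real_cos θ n
  obtain ⟨p, hp | hp⟩ := m.even_or_odd'
  · have z : (S ℝ ((p : ℤ) - 1)).eval (2 * Real.cos θ) = 0 := by
      rw [e]
      have : ((((p : ℤ) - 1 : ℤ) : ℝ) + 1) * θ = Real.pi := by
        rw [hp] at hmθ
        push_cast at hmθ ⊢
        linarith
      rw [this, Real.sin_pi, zero_div]
    have a1 : ((m : ℤ) - 2) / 2 = p - 1 := by omega
    have a2 : ((m : ℤ) - 1) / 2 = p - 1 := by omega
    rw [a1, a2, z]
    simp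
  · have z : (S ℝ (p : ℤ)).eval (2 * Real.cos θ) + (S ℝ ((p : ℤ) - 1)).eval (2 * Real.cos θ)
        = 0 := by
      rw [e, e, ← add_div]
      have : (((p : ℤ) : ℝ) + 1) * θ = 2 * Real.pi - p * θ := by
        rw [hp] at hmθ
        push_cast at hmθ ⊢
        linarith
      rw [this, Real.sin_two_pi_sub]
      simp
    have a1 : ((m : ℤ) - 2) / 2 = p - 1 := by omega
    have a2 : ((m : ℤ) - 1) / 2 = p := by omega
    have a3 : ((m : ℤ) - 3) / 2 = p - 1 := by omega
    have a4 : (m : ℤ) / 2 = p := by omega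
    rw [a1, a2, a3, a4, z]
    simp

theorem geomReflection_mul_pow_ne_one {i j : B} (hij : i ≠ j) {n : ℕ} (hn : n ≠ 0)
    (h : M i j = 0 ∨ n < M i j) : (M.geomReflection i * M.geomReflection j) ^ n ≠ 1 := by
  classical
  intro h1
  have key := reflection_mul_reflection_pow_apply_self (M.titsForm_single_self i)
    (M.titsForm_single_self j) n _ (M.titsForm_mul_titsForm_sub_two i j).symm
  change ((M.geomReflection i * M.geomReflection j) ^ n) _ = _ at key
  rw [h1] at key
  have ki := congrFun key i
  have kj := congrFun key j
  simp [hij, hij.symm] at ki kj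
  have hji := M.titsForm_single j i
  rw [M.symmetric j i] at hji
  rw [hji] at kj
  obtain h0 | h0 := eq_or_ne (M i j) 0
  · simp [h0] at kj
    exact hn kj
  have hlt := h.resolve_left h0
  have h1 := M.off_diagonal i j hij
  obtain h2 | h2 := eq_or_ne (M i j) 2
  · have : n = 1 := by omega
    simp [this, h2] at ki
  have h3 : 3 ≤ M i j := by omega
  have hm3 : (3 : ℝ) ≤ M i j := by exact_mod_cast h3
  have hc : Real.cos (Real.pi / M i j) ≠ 0 := by
    apply ne_of_gt
    apply Real.cos_pos_of_mem_Ioo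
    constructor
    · have : 0 < Real.pi / M i j := by positivity
      linarith [Real.pi_pos]
    · rw [div_lt_div_iff₀ (by positivity) (by positivity)]
      nlinarith [Real.pi_pos]
  set m := M i j with hm
  set θ := 2 * Real.pi / m with hθ
  have hsin : Real.sin θ ≠ 0 := by
    apply ne_of_gt
    apply Real.sin_pos_of_pos_of_lt_pi
    · rw [hθ]; positivity
    · rw [hθ, div_lt_iff₀ (by positivity)]
      nlinarith [Real.pi_pos]
  replace kj := kj.resolve_right (by simpa using hc)
  rw [kj, add_zero] at ki
  have e1 := S_two_mul_real_cos θ (n - 1)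
  have e2 := S_two_mul_real_cos θ n
  rw [kj] at e1
  rw [← ki] at e2
  push_cast at e1 e2
  rw [sub_add_cancel, zero_mul] at e1
  rw [add_mul, Real.sin_add, ← e1, one_mul, zero_mul, zero_add, one_mul] at e2
  have hcos : Real.cos (n * θ) = 1 := mul_right_cancel₀ hsin (by rw [one_mul]; exact e2.symm)
  have hpos : 0 < n * θ := by
    have : 0 < n := Nat.pos_of_ne_zero hn
    rw [hθ]
    positivity
  have hlt' : n * θ < 2 * Real.pi := by
    rw [hθ, ← mul_div_assoc, div_lt_iff₀ (by positivity), mul_comm]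
    have : (n : ℝ) < m := by exact_mod_cast hlt
    exact mul_lt_mul_of_pos_left this Real.two_pi_pos
  exact hpos.ne' ((Real.cos_eq_one_iff_of_lt_of_lt (by linarith [Real.pi_pos]) hlt').1 hcos)

end CoxeterMatrix

namespace CoxeterSystem

variable {B W : Type*} [Group W] {M : CoxeterMatrix B} (cs : CoxeterSystem M W)

theorem simple_mul_simple_pow_ne_one [Finite B] {i j : B} (hij : i ≠ j) {n : ℕ} (hn : n ≠ 0)
    (h : M i j = 0 ∨ n < M i j) : (cs.simple i * cs.simple j) ^ n ≠ 1 := by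
  intro h1
  apply M.geomReflection_mul_pow_ne_one hij hn h
  simpa using congrArg (cs.lift ⟨_, M.isLiftable_geomReflection⟩) h1

end CoxeterSystem

namespace CoxeterSystem

variable {B W : Type*} [Group W] {M : CoxeterMatrix B} (cs : CoxeterSystem M W)

local prefix:100 "s" => cs.simple
local prefix:100 "π" => cs.wordProd
local prefix:100 "ℓ" => cs.length

open Classical in
/-- The generators of the action of a Coxeter group on `W × ZMod 2` which conjugates the first
component and counts, modulo 2, the crossings of the corresponding reflection. -/
noncomputable def signedConj (i : B) : Equiv.Perm (W × ZMod 2) :=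
  Function.Involutive.toPerm
    (fun p ↦ (s i * p.1 * s i, p.2 + if p.1 = s i then 1 else 0)) fun ⟨t, e⟩ ↦ by
      have h : s i * t * s i = s i ↔ t = s i := by
        rw [mul_assoc, mul_eq_left, mul_eq_one_iff_eq_inv, inv_simple]
      ext1
      · simp [mul_assoc]
      · simp only [h, add_assoc, CharTwo.add_self_eq_zero, add_zero]

theorem signedConj_apply [DecidableEq W] (i : B) (p : W × ZMod 2) :
    cs.signedConj i p = (s i * p.1 * s i, p.2 + if p.1 = s i then 1 else 0) := by
  have h : cs.signedConj i p =
    (s i * p.1 * s i, p.2 + @ite _ (p.1 = s i) (Classical.propDecidable _) 1 0) := rfl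
  rw [h]
  congr

theorem simple_mul_pow_mul_simple (i j : B) (k : ℕ) :
    s j * (s i * s j) ^ k = ((s i * s j) ^ k)⁻¹ * s j := by
  induction k with
  | zero => simp
  | succ k ih =>
    have h : s j * (s i * s j) = (s i * s j)⁻¹ * s j := by simp [mul_assoc]
    rw [pow_succ, ← mul_assoc, ih, mul_assoc, h, mul_inv_rev ((s i * s j) ^ k), ← mul_assoc,
      ← mul_inv_rev, ← mul_inv_rev, ← pow_succ', ← pow_succ]

theorem signedConj_mul_pow_apply [DecidableEq W] (i j : B) (k : ℕ) (t : W) (e : ZMod 2) :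
    ((cs.signedConj i * cs.signedConj j) ^ k) (t, e) =
      ((s i * s j) ^ k * t * ((s i * s j) ^ k)⁻¹,
        e + ∑ n ∈ Finset.range (2 * k), if t = s j * (s i * s j) ^ n then 1 else 0) := by
  induction k with
  | zero => simp
  | succ k ih =>
    rw [pow_succ', Equiv.Perm.mul_apply, ih, Equiv.Perm.mul_apply, signedConj_apply,
      signedConj_apply, mul_add, mul_one, Finset.sum_range_succ, Finset.sum_range_succ]
    have h (n : ℕ) : s j * (s i * s j) ^ (2 * k + n) =
        ((s i * s j) ^ k)⁻¹ * (s j * (s i * s j) ^ n) * (s i * s j) ^ k := by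
      rw [← mul_assoc, ← simple_mul_pow_mul_simple, mul_assoc, mul_assoc, ← pow_add, ← pow_add]
      congr 2
      omega
    have h0 : (s i * s j) ^ k * t * ((s i * s j) ^ k)⁻¹ = s j ↔
        t = s j * (s i * s j) ^ (2 * k) := by
      have := h 0
      rw [add_zero] at this
      rw [this, mul_inv_eq_iff_eq_mul, ← eq_inv_mul_iff_mul_eq]
      simp [mul_assoc]
    have h1 : s j * ((s i * s j) ^ k * t * ((s i * s j) ^ k)⁻¹) * s j = s i ↔
        t = s j * (s i * s j) ^ (2 * k + 1) := by
      have aux (x : W) : s j * x * s j = s i ↔ x = s j * (s i * s j) := by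
        constructor <;> rintro h
        · simp [← h, mul_assoc]
        · simp [h, mul_assoc]
      rw [h 1, aux, mul_inv_eq_iff_eq_mul, ← eq_inv_mul_iff_mul_eq]
      simp [mul_assoc]
    ext1
    · simp [pow_succ', mul_assoc]
    · simp only [h0, h1]
      ring

theorem isLiftable_signedConj : M.IsLiftable cs.signedConj := by
  classical
  intro i j
  ext1 ⟨t, e⟩
  rw [signedConj_mul_pow_apply, simple_mul_simple_pow, two_mul, Finset.sum_range_add]
  simp [pow_add, CharTwo.add_self_eq_zero]

/-- The action of a Coxeter group on `W × ZMod 2` generated by `signedConj`. -/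
noncomputable def signedConjHom : W →* Equiv.Perm (W × ZMod 2) :=
  cs.lift ⟨_, cs.isLiftable_signedConj⟩

theorem signedConjHom_wordProd [DecidableEq W] (ω : List B) (t : W) (e : ZMod 2) :
    cs.signedConjHom (π ω) (t, e) =
      (π ω * t * (π ω)⁻¹, e + (List.count t (cs.rightInvSeq ω) : ZMod 2)) := by
  induction ω with
  | nil => simp
  | cons i ω ih =>
    have h : π ω * t * (π ω)⁻¹ = s i ↔ (π ω)⁻¹ * s i * π ω = t := by
      constructor <;> rintro h
      · rw [← h]; group
      · rw [← h]; group
    rw [wordProd_cons, map_mul, Equiv.Perm.mul_apply, ih, signedConjHom,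
      lift_apply_simple, signedConj_apply, rightInvSeq, List.count_cons]
    simp only [h, beq_iff_eq]
    ext1
    · simp [mul_assoc]
    · push_cast
      ring

theorem signedConjHom_apply_fst (w t : W) (e : ZMod 2) :
    (cs.signedConjHom w (t, e)).1 = w * t * w⁻¹ := by
  classical
  obtain ⟨ω, rfl⟩ := cs.wordProd_surjective w
  rw [signedConjHom_wordProd]

theorem signedConjHom_apply_add (w t : W) (e d : ZMod 2) :
    (cs.signedConjHom w (t, e + d)).2 = (cs.signedConjHom w (t, e)).2 + d := by
  classical
  obtain ⟨ω, rfl⟩ := cs.wordProd_surjective w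
  rw [signedConjHom_wordProd, signedConjHom_wordProd]
  ring

theorem IsReflection.signedConjHom_apply_self {t : W} (ht : cs.IsReflection t) :
    cs.signedConjHom t (t, 0) = (t, 1) := by
  classical
  obtain ⟨u, i, rfl⟩ := ht
  have h1 : cs.signedConjHom u⁻¹ (u * s i * u⁻¹, 0) =
      (s i, (cs.signedConjHom u⁻¹ (u * s i * u⁻¹, 0)).2) := by
    ext1
    · rw [signedConjHom_apply_fst]; group
    · rfl
  have h2 : cs.signedConjHom u (cs.signedConjHom u⁻¹ (u * s i * u⁻¹, 0)) =
      (u * s i * u⁻¹, 0) := by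
    rw [← Equiv.Perm.mul_apply, ← map_mul]
    simp
  have h3 (e : ZMod 2) : cs.signedConjHom (s i) (s i, e) = (s i, e + 1) := by
    rw [signedConjHom, lift_apply_simple, signedConj_apply]
    simp
  rw [h1] at h2
  ext1
  · rw [signedConjHom_apply_fst]; group
  · rw [map_mul, map_mul, Equiv.Perm.mul_apply, Equiv.Perm.mul_apply, h1, h3,
      signedConjHom_apply_add, h2, zero_add]

/-- The strong exchange property. -/
theorem IsLeftInversion.mem_leftInvSeq {ω : List B} {t : W} (h : cs.IsLeftInversion (π ω) t) :
    t ∈ cs.leftInvSeq ω := by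
  classical
  have hcount (ω : List B) : (cs.signedConjHom (π ω)⁻¹ (t, 0)).2 =
      List.count t (cs.leftInvSeq ω) := by
    rw [← wordProd_reverse, signedConjHom_wordProd, rightInvSeq_reverse, List.count_reverse,
      zero_add]
  by_contra hmem
  have h0 := hcount ω
  rw [List.count_eq_zero_of_not_mem hmem] at h0
  obtain ⟨ω', hω', hw⟩ := cs.exists_isReduced (t * π ω)
  have h1 := hcount ω'
  rw [← hw, mul_inv_rev, h.1.inv, map_mul, Equiv.Perm.mul_apply,
    h.1.signedConjHom_apply_self, ← zero_add (1 : ZMod 2), signedConjHom_apply_add, h0] at h1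
  have hmem' : t ∈ cs.leftInvSeq ω' := by
    by_contra hmem'
    rw [List.count_eq_zero_of_not_mem hmem'] at h1
    simp at h1
  have h2 := (cs.isLeftInversion_of_mem_leftInvSeq hω' hmem').2
  rw [← hw, ← mul_assoc, h.1.mul_self, one_mul] at h2
  exact lt_asymm h.2 h2

theorem leftInvSeq_append (ω ω' : List B) :
    cs.leftInvSeq (ω ++ ω') =
      cs.leftInvSeq ω ++ (cs.leftInvSeq ω').map (MulAut.conj (π ω)) := by
  induction ω with
  | nil => simp
  | cons i ω ih => simp [leftInvSeq, ih, wordProd_cons]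

theorem IsLeftInversion.of_mul {u v t : W} (h : cs.IsLeftInversion (u * v) t) :
    cs.IsLeftInversion u t ∨ cs.IsLeftInversion v (u⁻¹ * t * u) := by
  obtain ⟨ω, hω, rfl⟩ := cs.exists_isReduced u
  obtain ⟨ω', hω', rfl⟩ := cs.exists_isReduced v
  rw [← wordProd_append] at h
  have hmem := h.mem_leftInvSeq
  rw [leftInvSeq_append, List.mem_append, List.mem_map] at hmem
  obtain hmem | ⟨r, hr, rfl⟩ := hmem
  · exact .inl (cs.isLeftInversion_of_mem_leftInvSeq hω hmem)
  · right
    convert cs.isLeftInversion_of_mem_leftInvSeq hω' hr using 1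
    simp [mul_assoc]

theorem mem_leftInvSeq_alternatingWord {i i' : B} {k : ℕ} {x : W}
    (hx : x ∈ cs.leftInvSeq (alternatingWord i i' k)) :
    ∃ j < k, x = (s (if Even k then i else i') * s (if Even k then i' else i)) ^ j *
      s (if Even k then i else i') := by
  induction k generalizing x with
  | zero => simp [alternatingWord] at hx
  | succ k ih =>
    rw [alternatingWord_succ', leftInvSeq, List.mem_cons, List.mem_map] at hx
    simp only [Nat.even_add_one, ite_not]
    obtain rfl | ⟨y, hy, rfl⟩ := hx
    · exact ⟨0, k.succ_pos, by simp⟩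
    · obtain ⟨j, hj, rfl⟩ := ih hy
      refine ⟨j + 1, by omega, ?_⟩
      generalize (if Even k then i else i') = c
      generalize (if Even k then i' else i) = d
      have h (n : ℕ) : s d * (s c * s d) ^ n = (s d * s c) ^ n * s d :=
        (mul_pow_mul _ _ n).symm
      rw [MulAut.conj_apply, inv_simple, pow_succ, ← mul_assoc (s d), ← mul_assoc, h]

theorem length_alternatingWord_eq [Finite B] {i i' : B} (hi : i ≠ i') {k : ℕ}
    (hk : M i i' = 0 ∨ k ≤ M i i') : ℓ (π (alternatingWord i i' k)) = k := by
  induction k with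
  | zero => simp [alternatingWord]
  | succ k ih =>
    specialize ih (hk.imp_right Nat.le_of_succ_le)
    rw [alternatingWord_succ', wordProd_cons]
    obtain h | h := cs.length_simple_mul (π (alternatingWord i i' k)) (if Even k then i' else i)
    · rw [h, ih]
    exfalso
    have hd : cs.IsLeftDescent (π (alternatingWord i i' k)) (if Even k then i' else i) := by
      rw [IsLeftDescent]
      omega
    rw [← isLeftInversion_simple_iff_isLeftDescent] at hd
    obtain ⟨j, hj, h⟩ := cs.mem_leftInvSeq_alternatingWord hd.mem_leftInvSeq
    have hp : (s (if Even k then i else i') * s (if Even k then i' else i)) ^ (j + 1) = 1 := by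
      rw [pow_succ, ← mul_assoc, ← h, simple_mul_simple_self]
    split_ifs at hp with hev
    · exact cs.simple_mul_simple_pow_ne_one hi j.succ_ne_zero
        (hk.imp_right fun hk ↦ by omega) hp
    · rw [M.symmetric] at hk
      exact cs.simple_mul_simple_pow_ne_one hi.symm j.succ_ne_zero
        (hk.imp_right fun hk ↦ by omega) hp

theorem exists_eq_alternatingWord_mul [Finite B] {w : W} {i i' : B} (hi : i ≠ i')
    (h : cs.IsLeftDescent w i) (h' : cs.IsLeftDescent w i') {k : ℕ}
    (hk : M i i' = 0 ∨ k ≤ M i i') :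
    ∃ v, w = π (alternatingWord i i' k) * v ∧ ℓ w = k + ℓ v := by
  induction k with
  | zero => exact ⟨w, by simp [alternatingWord]⟩
  | succ k ih =>
    obtain ⟨v, hv, hl⟩ := ih (hk.imp_right Nat.le_of_succ_le)
    have hred := cs.length_alternatingWord_eq hi (hk.imp_right Nat.le_of_succ_le)
    have hred' := cs.length_alternatingWord_eq hi hk
    rw [alternatingWord_succ', wordProd_cons] at hred' ⊢
    set c := if Even k then i' else i with hc
    have hd : cs.IsLeftDescent w c := by rw [hc]; split_ifs <;> assumption
    have hd' := hd
    rw [← isLeftInversion_simple_iff_isLeftDescent, hv] at hd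
    obtain hd | hd := hd.of_mul
    · have := hd.2
      omega
    set u := π (alternatingWord i i' k)
    refine ⟨u⁻¹ * s c * u * v, ?_, ?_⟩
    · rw [hv]
      simp [mul_assoc]
    · have h1 := hd.2
      have h2 := cs.length_mul_le u (u⁻¹ * s c * u * v)
      have h3 : u * (u⁻¹ * s c * u * v) = s c * w := by rw [hv]; group
      rw [isLeftDescent_iff] at hd'
      rw [h3] at h2
      omega

theorem coxeterMatrix_ne_zero_of_isLeftDescent [Finite B] {w : W} {i i' : B} (hi : i ≠ i')
    (h : cs.IsLeftDescent w i) (h' : cs.IsLeftDescent w i') : M i i' ≠ 0 := by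
  intro h0
  obtain ⟨v, -, hl⟩ := cs.exists_eq_alternatingWord_mul hi h h' (k := ℓ w + 1) (.inl h0)
  omega

theorem isLeftDescent_wordProd_braidWord [Finite B] {i i' : B} (hi : i ≠ i') (hM : M i i' ≠ 0) :
    cs.IsLeftDescent (π (braidWord M i i')) i ∧ cs.IsLeftDescent (π (braidWord M i i')) i' := by
  obtain ⟨k, hk⟩ := Nat.exists_eq_add_one_of_ne_zero hM
  have key {a b : B} (hab : a ≠ b) (hk : M a b = k + 1) :
      cs.IsLeftDescent (π (braidWord M a b)) (if Even k then b else a) := by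
    have h := cs.length_alternatingWord_eq hab (k := k + 1) (by omega)
    have h' := cs.length_alternatingWord_eq hab (k := k) (by omega)
    rw [braidWord, hk, IsLeftDescent, h, alternatingWord_succ', wordProd_cons,
      simple_mul_simple_cancel_left, h']
    exact k.lt_succ_self
  have h1 := key hi hk
  have h2 := key hi.symm (M.symmetric i i' ▸ hk)
  rw [← wordProd_braidWord_eq] at h2
  split_ifs at h1 h2
  exacts [⟨h2, h1⟩, ⟨h1, h2⟩]

/-- The (right) weak order on a Coxeter group: `u` is the product of an initial segment of
a reduced word of `w`. -/
def IsPrefix (u w : W) : Prop := ℓ u + ℓ (u⁻¹ * w) = ℓ w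

variable {cs}

theorem isPrefix_mul_iff {u v : W} : cs.IsPrefix u (u * v) ↔ ℓ (u * v) = ℓ u + ℓ v := by
  rw [IsPrefix, inv_mul_cancel_left, eq_comm]

theorem IsPrefix.refl (u : W) : cs.IsPrefix u u := by simp [IsPrefix]

theorem one_isPrefix (w : W) : cs.IsPrefix 1 w := by simp [IsPrefix]

theorem isPrefix_simple_iff {w : W} {i : B} :
    cs.IsPrefix (s i) w ↔ cs.IsLeftDescent w i := by
  rw [IsPrefix, isLeftDescent_iff, inv_simple, length_simple, add_comm]

theorem IsPrefix.trans {u v w : W} (h : cs.IsPrefix u v) (h' : cs.IsPrefix v w) :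
    cs.IsPrefix u w := by
  unfold IsPrefix at *
  have h1 := cs.length_mul_le (u⁻¹ * v) (v⁻¹ * w)
  have h2 := cs.length_mul_le u (u⁻¹ * w)
  rw [mul_inv_cancel_left] at h2
  rw [mul_assoc, mul_inv_cancel_left] at h1
  omega

theorem IsPrefix.antisymm {u v : W} (h : cs.IsPrefix u v) (h' : cs.IsPrefix v u) : u = v := by
  unfold IsPrefix at *
  have : ℓ (u⁻¹ * v) = 0 := by omega
  rw [length_eq_zero_iff, inv_mul_eq_one] at this
  exact this

theorem IsPrefix.mul_left {u x y : W} (h : cs.IsPrefix u (u * y)) (h' : cs.IsPrefix x y) :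
    cs.IsPrefix u (u * x) ∧ cs.IsPrefix (u * x) (u * y) := by
  unfold IsPrefix at *
  simp only [inv_mul_cancel_left, mul_inv_rev, mul_assoc] at *
  have h1 := cs.length_mul_le u x
  have h2 := cs.length_mul_le (u * x) (x⁻¹ * y)
  rw [mul_assoc, mul_inv_cancel_left] at h2
  omega

theorem IsPrefix.of_mul_left {u x y : W} (h : cs.IsPrefix u (u * x))
    (h' : cs.IsPrefix (u * x) (u * y)) : cs.IsPrefix x y := by
  unfold IsPrefix at *
  simp only [inv_mul_cancel_left, mul_inv_rev, mul_assoc] at *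
  have h1 := cs.length_mul_le u y
  have h2 := cs.length_mul_le x (x⁻¹ * y)
  rw [mul_inv_cancel_left] at h2
  omega

theorem IsPrefix.exists_simple {x y : W} (h : cs.IsPrefix x y) (hne : x ≠ y) :
    ∃ i, cs.IsPrefix x (x * s i) ∧ cs.IsPrefix (x * s i) y := by
  obtain ⟨i, hi⟩ := cs.exists_leftDescent_of_ne_one (w := x⁻¹ * y) (by rwa [ne_eq, inv_mul_eq_one])
  refine ⟨i, ?_⟩
  rw [← isPrefix_simple_iff] at hi
  rw [← mul_inv_cancel_left x y] at h
  simpa using h.mul_left hi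

theorem exists_isPrefix_isPrefix [Finite B] {x : W} {i i' : B} (hi : i ≠ i') (U : Set W)
    (hU : U.Nonempty) (h : cs.IsPrefix x (x * s i)) (h' : cs.IsPrefix x (x * s i'))
    (hw : ∀ w ∈ U, cs.IsPrefix (x * s i) w) (hw' : ∀ w ∈ U, cs.IsPrefix (x * s i') w) :
    ∃ y, cs.IsPrefix (x * s i) y ∧ cs.IsPrefix (x * s i') y ∧ ∀ w ∈ U, cs.IsPrefix y w := by
  have desc {w : W} (hwU : w ∈ U) :
      cs.IsLeftDescent (x⁻¹ * w) i ∧ cs.IsLeftDescent (x⁻¹ * w) i' := by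
    rw [← isPrefix_simple_iff, ← isPrefix_simple_iff]
    have h1 := hw w hwU
    have h2 := hw' w hwU
    rw [← mul_inv_cancel_left x w] at h1 h2
    exact ⟨h.of_mul_left h1, h'.of_mul_left h2⟩
  have hM : M i i' ≠ 0 := by
    obtain ⟨w, hwU⟩ := hU
    exact cs.coxeterMatrix_ne_zero_of_isLeftDescent hi (desc hwU).1 (desc hwU).2
  have hpre {w : W} (hwU : w ∈ U) : cs.IsPrefix x (x * (π (braidWord M i i'))) ∧
      cs.IsPrefix (x * (π (braidWord M i i'))) w := by
    obtain ⟨v, hv, hl⟩ := cs.exists_eq_alternatingWord_mul hi (desc hwU).1 (desc hwU).2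
      (k := M i i') (.inr le_rfl)
    have hx : cs.IsPrefix x (x * (x⁻¹ * w)) := by
      rw [mul_inv_cancel_left]
      exact h.trans (hw w hwU)
    have := hx.mul_left (x := π (braidWord M i i')) (by
      rw [hv, isPrefix_mul_iff, ← hv, hl, braidWord, cs.length_alternatingWord_eq hi (.inr le_rfl)])
    rwa [mul_inv_cancel_left] at this
  obtain ⟨h1, h2⟩ := cs.isLeftDescent_wordProd_braidWord hi hM
  rw [← isPrefix_simple_iff] at h1 h2
  obtain ⟨w, hwU⟩ := hU
  exact ⟨_, ((hpre hwU).1.mul_left h1).2, ((hpre hwU).1.mul_left h2).2, fun w hw ↦ (hpre hw).2⟩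

/-- Nonempty sets have greatest lower bounds in the weak order. -/
theorem exists_greatest_isPrefix [Finite B] (U : Set W) (hU : U.Nonempty) :
    ∃ g, (∀ w ∈ U, cs.IsPrefix g w) ∧
      ∀ x, (∀ w ∈ U, cs.IsPrefix x w) → cs.IsPrefix x g := by
  obtain ⟨z, hz⟩ := hU
  have key (n : ℕ) : ∀ x, (∀ w ∈ U, cs.IsPrefix x w) → ℓ z - ℓ x = n →
      ∃ g, (∀ w ∈ U, cs.IsPrefix g w) ∧ cs.IsPrefix x g ∧
        ∀ y, (∀ w ∈ U, cs.IsPrefix y w) → cs.IsPrefix x y → cs.IsPrefix y g := by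
    induction n using Nat.strong_induction_on with
    | _ n ih =>
      intro x hx hn
      by_cases hmax : ∃ y, (∀ w ∈ U, cs.IsPrefix y w) ∧ cs.IsPrefix x y ∧ x ≠ y
      · have step {y : W} (hy : ∀ w ∈ U, cs.IsPrefix y w) (hxy : cs.IsPrefix x y) (hne : x ≠ y) :
            ∃ g, (∀ w ∈ U, cs.IsPrefix g w) ∧ cs.IsPrefix y g ∧
              ∀ y', (∀ w ∈ U, cs.IsPrefix y' w) → cs.IsPrefix y y' → cs.IsPrefix y' g := by
          refine ih (ℓ z - ℓ y) ?_ y hy rfl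
          have h1 : ℓ (x⁻¹ * y) ≠ 0 := by
            rwa [ne_eq, length_eq_zero_iff, inv_mul_eq_one]
          have h2 := hy z hz
          unfold IsPrefix at hxy h2
          omega
        have cover {y : W} (hy : ∀ w ∈ U, cs.IsPrefix y w) (hxy : cs.IsPrefix x y)
            (hne : x ≠ y) : ∃ i, cs.IsPrefix x (x * s i) ∧ cs.IsPrefix (x * s i) y ∧
              (∀ w ∈ U, cs.IsPrefix (x * s i) w) ∧ x ≠ x * s i := by
          obtain ⟨i, h1, h2⟩ := hxy.exists_simple hne
          refine ⟨i, h1, h2, fun w hw ↦ h2.trans (hy w hw), fun h ↦ ?_⟩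
          exact cs.length_mul_simple_ne x i (congrArg _ h).symm
        obtain ⟨y₀, hy₀, hxy₀, hne₀⟩ := hmax
        obtain ⟨i, hi1, -, hi2, hi3⟩ := cover hy₀ hxy₀ hne₀
        obtain ⟨g, hg, hig, hgmax⟩ := step hi2 hi1 hi3
        refine ⟨g, hg, hi1.trans hig, fun y hy hxy ↦ ?_⟩
        obtain rfl | hne := eq_or_ne x y
        · exact hi1.trans hig
        obtain ⟨j, hj1, hjy, hj2, hj3⟩ := cover hy hxy hne
        obtain rfl | hij := eq_or_ne i j
        · exact hgmax y hy hjy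
        obtain ⟨d, hid, hjd, hd⟩ := exists_isPrefix_isPrefix hij U ⟨z, hz⟩ hi1 hj1 hi2 hj2
        obtain ⟨g', hg', hjg', hgmax'⟩ := step hj2 hj1 hj3
        obtain ⟨e, he, hde, hemax⟩ := step hd (hi1.trans hid) (by
          rintro rfl
          exact hi3 (hi1.antisymm hid))
        exact ((hgmax' y hy hjy).trans (hemax g' hg' (hgmax' d hd hjd))).trans
          (hgmax e he (hid.trans hde))
      · refine ⟨x, hx, .refl x, fun y hy hxy ↦ ?_⟩
        by_contra h
        exact hmax ⟨y, hy, hxy, fun h' ↦ h (h' ▸ .refl x)⟩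
  obtain ⟨g, h1, -, h2⟩ := key _ 1 (fun w _ ↦ one_isPrefix w) rfl
  exact ⟨g, h1, fun x hx ↦ h2 x hx (one_isPrefix x)⟩

variable (cs)

/-- A finite Coxeter group has a greatest element in the weak order. -/
theorem exists_forall_isPrefix [Finite W] : ∃ z, ∀ w, cs.IsPrefix w z := by
  obtain ⟨z, hz⟩ := Finite.exists_max cs.length
  refine ⟨z, fun w ↦ ?_⟩
  induction w using cs.simple_induction_right with
  | one => exact one_isPrefix z
  | mul_simple_right u i ih =>
    have hinv : (u * s i)⁻¹ * z = s i * (u⁻¹ * z) := by simp [mul_assoc]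
    unfold IsPrefix at *
    rw [hinv]
    have h2 := cs.length_mul_le (u * s i) (s i * (u⁻¹ * z))
    have h3 : u * s i * (s i * (u⁻¹ * z)) = z := by simp [mul_assoc]
    rw [h3] at h2
    obtain h | h := cs.length_mul_simple u i
    · have ht : cs.IsReflection (u * s i * u⁻¹) := ⟨u, i, rfl⟩
      have hzt : cs.IsLeftInversion (u * (u⁻¹ * z)) (u * s i * u⁻¹) := by
        rw [mul_inv_cancel_left]
        exact ⟨ht, lt_of_le_of_ne (hz _) (ht.length_mul_right_ne z)⟩
      obtain h1 | h1 := hzt.of_mul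
      · have := h1.2
        rw [inv_mul_cancel_right] at this
        omega
      · have h4 : u⁻¹ * (u * s i * u⁻¹) * u = s i := by group
        rw [h4, isLeftInversion_simple_iff_isLeftDescent, isLeftDescent_iff] at h1
        omega
    · obtain h1 | h1 := cs.length_simple_mul (u⁻¹ * z) i <;> omega

theorem exists_least_upper_isPrefix [Finite B] [Finite W] (u v : W) :
    ∃ j, (cs.IsPrefix u j ∧ cs.IsPrefix v j) ∧
      ∀ w, cs.IsPrefix u w → cs.IsPrefix v w → cs.IsPrefix j w := by
  obtain ⟨z, hz⟩ := cs.exists_forall_isPrefix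
  obtain ⟨g, h1, h2⟩ := exists_greatest_isPrefix (cs := cs)
    {w | cs.IsPrefix u w ∧ cs.IsPrefix v w} ⟨z, hz u, hz v⟩
  exact ⟨g, ⟨h2 u fun w hw ↦ hw.1, h2 v fun w hw ↦ hw.2⟩, fun w hu hv ↦ h1 w ⟨hu, hv⟩⟩

section Complement

variable [Finite B] [Finite W]

/-- The join of two elements of a finite Coxeter group in the weak order. -/
noncomputable def weakSup (u v : W) : W := (cs.exists_least_upper_isPrefix u v).choose

theorem isPrefix_weakSup_left (u v : W) : cs.IsPrefix u (cs.weakSup u v) :=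
  (cs.exists_least_upper_isPrefix u v).choose_spec.1.1

theorem isPrefix_weakSup_right (u v : W) : cs.IsPrefix v (cs.weakSup u v) :=
  (cs.exists_least_upper_isPrefix u v).choose_spec.1.2

variable {cs} in
theorem IsPrefix.weakSup_isPrefix {u v w : W} (hu : cs.IsPrefix u w) (hv : cs.IsPrefix v w) :
    cs.IsPrefix (cs.weakSup u v) w :=
  (cs.exists_least_upper_isPrefix u v).choose_spec.2 w hu hv

theorem weakSup_comm (u v : W) : cs.weakSup u v = cs.weakSup v u :=
  ((cs.isPrefix_weakSup_right v u).weakSup_isPrefix (cs.isPrefix_weakSup_left v u)).antisymm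
    ((cs.isPrefix_weakSup_right u v).weakSup_isPrefix (cs.isPrefix_weakSup_left u v))

/-- The right complement of `u` in the join of `u` and `v`. -/
noncomputable def complement (u v : W) : W := u⁻¹ * cs.weakSup u v

theorem complement_def (u v : W) : cs.complement u v = u⁻¹ * cs.weakSup u v := rfl

theorem mul_complement (u v : W) : u * cs.complement u v = cs.weakSup u v :=
  mul_inv_cancel_left _ _

theorem weakSup_one_left (v : W) : cs.weakSup 1 v = v :=
  ((one_isPrefix v).weakSup_isPrefix (.refl v)).antisymm (cs.isPrefix_weakSup_right 1 v)

theorem weakSup_self (v : W) : cs.weakSup v v = v :=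
  ((IsPrefix.refl v).weakSup_isPrefix (.refl v)).antisymm (cs.isPrefix_weakSup_right v v)

@[simp]
theorem complement_one_left (v : W) : cs.complement 1 v = v := by
  rw [complement, weakSup_one_left, inv_one, one_mul]

@[simp]
theorem complement_one_right (v : W) : cs.complement v 1 = 1 := by
  rw [complement, weakSup_comm, weakSup_one_left, inv_mul_cancel]

@[simp]
theorem complement_self (v : W) : cs.complement v v = 1 := by
  rw [complement, weakSup_self, inv_mul_cancel]

variable {cs}

theorem weakSup_mul_left {u u' : W} (h : cs.IsPrefix u (u * u')) (v : W) :
    cs.weakSup (u * u') v = u * cs.weakSup u' (cs.complement u v) := by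
  obtain ⟨x, hx⟩ : ∃ x, cs.weakSup (u * u') v = u * x := ⟨_, (mul_inv_cancel_left u _).symm⟩
  have h1 : cs.IsPrefix (u * u') (u * x) := hx ▸ cs.isPrefix_weakSup_left _ _
  have hux := h.trans h1
  have hv : cs.IsPrefix v (u * x) := hx ▸ cs.isPrefix_weakSup_right _ _
  have h2 : cs.IsPrefix (u * cs.complement u v) (u * x) :=
    cs.mul_complement u v ▸ hux.weakSup_isPrefix hv
  have huc : cs.IsPrefix u (u * cs.complement u v) :=
    cs.mul_complement u v ▸ cs.isPrefix_weakSup_left u v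
  have hle := hux.mul_left ((h.of_mul_left h1).weakSup_isPrefix (huc.of_mul_left h2))
  rw [hx]
  refine IsPrefix.antisymm ?_ hle.2
  rw [← hx]
  refine (hle.1.mul_left (cs.isPrefix_weakSup_left _ _)).2.weakSup_isPrefix ?_
  refine (cs.isPrefix_weakSup_right u v).trans ?_
  rw [← mul_complement]
  exact (hle.1.mul_left (cs.isPrefix_weakSup_right _ _)).2

theorem complement_mul_left {u u' : W} (h : cs.IsPrefix u (u * u')) (v : W) :
    cs.complement (u * u') v = cs.complement u' (cs.complement u v) := by
  rw [complement, weakSup_mul_left h, cs.complement_def u', mul_inv_rev, mul_assoc,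
    inv_mul_cancel_left]

theorem complement_mul_right {u u' : W} (h : cs.IsPrefix u (u * u')) (v : W) :
    cs.complement v (u * u') =
      cs.complement v u * cs.complement (cs.complement u v) u' := by
  rw [complement, weakSup_comm, weakSup_mul_left h, cs.complement_def v, cs.weakSup_comm v u,
    cs.complement_def _ u', cs.weakSup_comm _ u', ← cs.mul_complement u v]
  group

theorem isPrefix_complement_mul {u u' : W} (h : cs.IsPrefix u (u * u')) (v : W) :
    cs.IsPrefix (cs.complement v u)
      (cs.complement v u * cs.complement (cs.complement u v) u') := by
  rw [← complement_mul_right h]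
  have h1 : cs.IsPrefix v (v * cs.complement v u) :=
    cs.mul_complement v u ▸ cs.isPrefix_weakSup_left v u
  refine h1.of_mul_left ?_
  rw [mul_complement, mul_complement]
  exact (cs.isPrefix_weakSup_left v (u * u')).weakSup_isPrefix
    (h.trans (cs.isPrefix_weakSup_right v (u * u')))

end Complement

end CoxeterSystem

namespace ArtinTitsMonoid

open CoxeterSystem

variable {B : Type*} {M : CoxeterMatrix B}

variable (M) in
/-- The product of a word in the generators of the Artin–Tits monoid. -/
def ofWord (ω : List B) : ArtinTitsMonoid M :=
  PresentedMonoid.mk (artinTitsRels M) (FreeMonoid.ofList ω)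

theorem ofWord_nil : ofWord M [] = 1 := rfl

theorem ofWord_append (ω ω' : List B) : ofWord M (ω ++ ω') = ofWord M ω * ofWord M ω' := rfl

theorem ofWord_cons (i : B) (ω : List B) : ofWord M (i :: ω) = ofWord M [i] * ofWord M ω := rfl

theorem ofWord_surjective : Function.Surjective (ofWord M) := fun a ↦ by
  induction a using PresentedMonoid.inductionOn with
  | _ ω => exact ⟨FreeMonoid.toList ω, rfl⟩

theorem ofWord_alternatingWord {i i' : B} (hi : i ≠ i') (hM : M i i' ≠ 0) :
    ofWord M (alternatingWord i i' (M i i')) = ofWord M (alternatingWord i' i (M i i')) :=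
  Quotient.sound (ConGen.Rel.of _ _ ⟨i, i', hi, hM, rfl, rfl⟩)

/-- The homomorphism out of the Artin–Tits monoid induced by elements satisfying the
braid relations. -/
def lift {N : Type*} [Monoid N] (f : B → N) (hf : ∀ i i', i ≠ i' → M i i' ≠ 0 →
    ((alternatingWord i i' (M i i')).map f).prod = ((alternatingWord i' i (M i i')).map f).prod) :
    ArtinTitsMonoid M →* N :=
  PresentedMonoid.lift f <| by
    rintro _ _ ⟨i, i', hi, hM, rfl, rfl⟩
    simpa [FreeMonoid.lift_apply] using hf i i' hi hM

theorem lift_ofWord {N : Type*} [Monoid N] {f : B → N} (hf) (ω : List B) :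
    lift (M := M) f hf (ofWord M ω) = (ω.map f).prod := by
  change FreeMonoid.lift f (FreeMonoid.ofList ω) = _
  simp [FreeMonoid.lift_apply]

section Matsumoto

variable {W : Type*} [Group W] (cs : CoxeterSystem M W)

theorem isReduced_of_cons {i : B} {ω : List B} (h : cs.IsReduced (i :: ω)) : cs.IsReduced ω :=
  h.drop 1

/-- Matsumoto's theorem. -/
theorem ofWord_eq_of_isReduced [Finite B] {ω ω' : List B} (hω : cs.IsReduced ω)
    (hω' : cs.IsReduced ω') (h : cs.wordProd ω = cs.wordProd ω') : ofWord M ω = ofWord M ω' := by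
  have hl : ω.length = ω'.length := by rw [← hω, ← hω', h]
  induction hn : ω.length generalizing ω ω' with
  | zero => rw [List.length_eq_zero_iff.1 hn, List.length_eq_zero_iff.1 (hl.symm.trans hn)]
  | succ n ih =>
    have tail {i : B} {ω ω' : List B} (hω : cs.IsReduced (i :: ω)) (hω' : cs.IsReduced (i :: ω'))
        (h : cs.wordProd (i :: ω) = cs.wordProd (i :: ω')) (hn : (i :: ω).length = n + 1) :
        ofWord M (i :: ω) = ofWord M (i :: ω') := by
      have hl : (i :: ω).length = (i :: ω').length := by rw [← hω, ← hω', h]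
      simp only [wordProd_cons, mul_right_inj] at h
      simp only [List.length_cons, Nat.add_right_cancel_iff] at hl hn
      rw [ofWord_cons, ih (isReduced_of_cons cs hω) (isReduced_of_cons cs hω') h hl hn,
        ← ofWord_cons]
    match ω, ω' with
    | [], _ => simp at hn
    | _ :: _, [] => simp at hl
    | i :: ω, i' :: ω' =>
      obtain rfl | hi := eq_or_ne i i'
      · exact tail hω hω' h hn
      have desc {j : B} {η : List B} (hη : cs.IsReduced (j :: η)) :
          cs.IsLeftDescent (cs.wordProd (j :: η)) j := by
        rw [IsLeftDescent, hη, wordProd_cons, simple_mul_simple_cancel_left,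
          isReduced_of_cons cs hη]
        simp
      have h1 := desc hω
      have h2 := h ▸ desc hω'
      have hM := cs.coxeterMatrix_ne_zero_of_isLeftDescent hi h1 h2
      obtain ⟨v, hv, hvl⟩ := cs.exists_eq_alternatingWord_mul hi h1 h2 (k := M i i') (.inr le_rfl)
      obtain ⟨η, hη, rfl⟩ := cs.exists_isReduced v
      have hb : cs.wordProd (alternatingWord i i' (M i i')) =
          cs.wordProd (alternatingWord i' i (M i i')) := by
        have := cs.wordProd_braidWord_eq i i'
        rwa [braidWord, braidWord, M.symmetric i' i] at this
      have key {c d : B} {ω₁ ω₂ ζ ζ' : List B} (h₁ : cs.IsReduced (c :: ω₁))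
          (h₂ : cs.IsReduced (d :: ω₂)) (hln : (c :: ω₁).length = n + 1)
          (h12 : cs.wordProd (c :: ω₁) = cs.wordProd (d :: ω₂))
          (e : cs.wordProd (c :: ω₁) = cs.wordProd (c :: ζ))
          (e' : cs.wordProd (c :: ω₁) = cs.wordProd (d :: ζ'))
          (hr : cs.IsReduced (c :: ζ)) (hr' : cs.IsReduced (d :: ζ'))
          (hz : ofWord M (c :: ζ) = ofWord M (d :: ζ')) :
          ofWord M (c :: ω₁) = ofWord M (d :: ω₂) := by
        rw [tail h₁ hr e hln, hz]
        refine tail hr' h₂ (e'.symm.trans h12) ?_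
        rw [← hr', ← e', h₁, hln]
      have red {a b : B} (e : cs.wordProd (i :: ω) =
          cs.wordProd (alternatingWord a b (M i i')) * cs.wordProd η) :
          cs.IsReduced (alternatingWord a b (M i i') ++ η) := by
        rw [CoxeterSystem.IsReduced, wordProd_append, ← e, hvl, hη,
            List.length_append, length_alternatingWord]
      have r1 := red hv
      have hv' := hb ▸ hv
      have r2 := red hv'
      have hz : ofWord M (alternatingWord i i' (M i i') ++ η) =
          ofWord M (alternatingWord i' i (M i i') ++ η) := by
        rw [ofWord_append, ofWord_append, ofWord_alternatingWord hi hM]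
      rw [← wordProd_append] at hv hv'
      obtain ⟨k, hk⟩ := Nat.exists_eq_add_one_of_ne_zero hM
      rw [hk, alternatingWord_succ', List.cons_append] at hv hv' r1 r2 hz
      rw [alternatingWord_succ', List.cons_append] at hz
      split_ifs at hv hv' r1 r2 hz
      · exact key hω hω' hn h hv' hv r2 r1 hz.symm
      · exact key hω hω' hn h hv hv' r1 r2 hz

/-- The lift of an element of the Coxeter group to the Artin–Tits monoid. -/
noncomputable def ofGroup (w : W) : ArtinTitsMonoid M := ofWord M (cs.exists_isReduced w).choose

variable [Finite B]

theorem ofGroup_wordProd {ω : List B} (hω : cs.IsReduced ω) :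
    ofGroup cs (cs.wordProd ω) = ofWord M ω :=
  have h := (cs.exists_isReduced (cs.wordProd ω)).choose_spec
  ofWord_eq_of_isReduced cs h.1 hω h.2.symm

theorem ofGroup_one : ofGroup cs 1 = 1 := by
  rw [← cs.wordProd_nil, ofGroup_wordProd cs (by simp [CoxeterSystem.IsReduced]), ofWord_nil]

theorem ofGroup_simple (i : B) : ofGroup cs (cs.simple i) = ofWord M [i] := by
  rw [← cs.wordProd_singleton, ofGroup_wordProd cs (by simp [CoxeterSystem.IsReduced])]

theorem ofGroup_mul {u v : W} (h : cs.IsPrefix u (u * v)) :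
    ofGroup cs (u * v) = ofGroup cs u * ofGroup cs v := by
  obtain ⟨ω, hω, rfl⟩ := cs.exists_isReduced u
  obtain ⟨ω', hω', rfl⟩ := cs.exists_isReduced v
  rw [ofGroup_wordProd cs hω, ofGroup_wordProd cs hω', ← ofWord_append, ← wordProd_append,
    ofGroup_wordProd]
  rw [isPrefix_mul_iff, hω, hω', ← wordProd_append] at h
  rw [CoxeterSystem.IsReduced, h, List.length_append]

end Matsumoto

section Action

variable {W : Type*} [Group W] (cs : CoxeterSystem M W) [Finite B] [Finite W]

/-- Right multiplication by a generator, transported along the complement. -/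
noncomputable def divStep (p : W × ArtinTitsMonoid M) (i : B) : W × ArtinTitsMonoid M :=
  (cs.complement (cs.simple i) p.1, p.2 * ofGroup cs (cs.complement p.1 (cs.simple i)))

theorem foldl_divStep (p : W × ArtinTitsMonoid M) {ω : List B} (hω : cs.IsReduced ω) :
    ω.foldl (divStep cs) p = (cs.complement (cs.wordProd ω) p.1,
      p.2 * ofGroup cs (cs.complement p.1 (cs.wordProd ω))) := by
  induction ω using List.reverseRecOn with
  | nil => simp [ofGroup_one]
  | append_singleton ω i ih =>
    have hω' : cs.IsReduced ω := by simpa using hω.take ω.length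
    have h : cs.IsPrefix (cs.wordProd ω) (cs.wordProd ω * cs.simple i) := by
      rw [isPrefix_mul_iff, ← wordProd_concat, List.concat_eq_append, hω, hω']
      simp
    rw [List.foldl_append, ih hω', wordProd_append, wordProd_singleton, complement_mul_left h,
      complement_mul_right h, ofGroup_mul cs (isPrefix_complement_mul h _), ← mul_assoc]
    rfl

theorem foldl_divStep_alternatingWord {i i' : B} (hi : i ≠ i') (p : W × ArtinTitsMonoid M) :
    (alternatingWord i i' (M i i')).foldl (divStep cs) p =
      (alternatingWord i' i (M i i')).foldl (divStep cs) p := by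
  have h := cs.wordProd_braidWord_eq i i'
  rw [braidWord, braidWord, M.symmetric i' i] at h
  rw [foldl_divStep, foldl_divStep, h]
  · rw [CoxeterSystem.IsReduced, cs.length_alternatingWord_eq hi.symm (.inr (M.symmetric i i').le),
      length_alternatingWord]
  · rw [CoxeterSystem.IsReduced, cs.length_alternatingWord_eq hi (.inr le_rfl), length_alternatingWord]

theorem unop_prod_map_divStep (ω : List B) (p : W × ArtinTitsMonoid M) :
    ((ω.map fun i ↦ MulOpposite.op (α := Function.End (W × ArtinTitsMonoid M))
      fun p ↦ divStep cs p i).prod.unop : Function.End _) p = ω.foldl (divStep cs) p := by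
  induction ω generalizing p with
  | nil => rfl
  | cons i ω ih =>
    rw [List.map_cons, List.prod_cons, List.foldl_cons, ← ih]
    rfl

/-- The right action of the Artin–Tits monoid generated by `divStep`. -/
noncomputable def divHom : ArtinTitsMonoid M →* (Function.End (W × ArtinTitsMonoid M))ᵐᵒᵖ :=
  lift (fun i ↦ .op fun p ↦ divStep cs p i) fun i i' hi _ ↦ MulOpposite.unop_injective <|
    funext fun p ↦ by
      rw [unop_prod_map_divStep, unop_prod_map_divStep, foldl_divStep_alternatingWord cs hi]

theorem divHom_ofWord (ω : List B) (p : W × ArtinTitsMonoid M) :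
    (divHom cs (ofWord M ω)).unop p = ω.foldl (divStep cs) p := by
  rw [divHom, lift_ofWord, unop_prod_map_divStep]

theorem foldl_divStep_one (ω : List B) (a : ArtinTitsMonoid M) :
    ω.foldl (divStep cs) (1, a) = (1, a * ofWord M ω) := by
  induction ω generalizing a with
  | nil => rw [ofWord_nil, mul_one, List.foldl_nil]
  | cons i ω ih =>
    rw [List.foldl_cons, divStep, complement_one_left, complement_one_right, ih, ofGroup_simple,
      mul_assoc, ← ofWord_cons]

theorem foldl_divStep_simple_cons (i : B) (ω : List B) :
    (i :: ω).foldl (divStep cs) (cs.simple i, 1) = (1, ofWord M ω) := by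
  rw [List.foldl_cons, divStep, complement_self, ofGroup_one, foldl_divStep_one, one_mul, one_mul]

/-- An Artin–Tits monoid of spherical type is left-cancellative. -/
theorem mul_left_cancel_of_finite (cs : CoxeterSystem M W) {a b c : ArtinTitsMonoid M}
    (h : a * b = a * c) : b = c := by
  obtain ⟨ω, rfl⟩ := ofWord_surjective a
  induction ω with
  | nil => simpa only [ofWord_nil, one_mul] using h
  | cons i ω ih =>
    apply ih
    rw [ofWord_cons, mul_assoc, mul_assoc] at h
    generalize ofWord M ω * b = x at h ⊢
    generalize ofWord M ω * c = y at h ⊢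
    obtain ⟨η, rfl⟩ := ofWord_surjective x
    obtain ⟨ζ, rfl⟩ := ofWord_surjective y
    rw [← ofWord_cons, ← ofWord_cons] at h
    have := congrArg (fun a ↦ (divHom cs a).unop (cs.simple i, 1)) h
    simp only [divHom_ofWord, foldl_divStep_simple_cons] at this
    exact congrArg Prod.snd this

end Action

section Reverse

theorem reverse_alternatingWord (i i' : B) (k : ℕ) :
    (alternatingWord i i' k).reverse =
      if Even k then alternatingWord i' i k else alternatingWord i i' k := by
  induction k generalizing i i' with
  | zero => simp [alternatingWord]
  | succ k ih =>
    rw [alternatingWord, List.concat_eq_append, List.reverse_append, ih, List.reverse_singleton,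
      List.singleton_append, ← List.concat_eq_append, ← alternatingWord, alternatingWord_succ',
      alternatingWord_succ']
    split_ifs <;> simp_all [Nat.even_add_one]

theorem prod_map_op_ofWord (ω : List B) :
    (ω.map fun i ↦ MulOpposite.op (ofWord M [i])).prod = .op (ofWord M ω.reverse) := by
  induction ω with
  | nil => rfl
  | cons i ω ih =>
    rw [List.map_cons, List.prod_cons, ih, List.reverse_cons, ofWord_append, MulOpposite.op_mul]

/-- The anti-automorphism of the Artin–Tits monoid reversing words. -/
def reverse : ArtinTitsMonoid M →* (ArtinTitsMonoid M)ᵐᵒᵖ :=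
  lift (fun i ↦ .op (ofWord M [i])) fun i i' hi hM ↦ by
    rw [prod_map_op_ofWord, prod_map_op_ofWord, reverse_alternatingWord, reverse_alternatingWord]
    split_ifs
    exacts [congrArg _ (ofWord_alternatingWord hi hM).symm,
      congrArg _ (ofWord_alternatingWord hi hM)]

theorem reverse_ofWord (ω : List B) : reverse (ofWord M ω) = .op (ofWord M ω.reverse) := by
  rw [reverse, lift_ofWord, prod_map_op_ofWord]

theorem reverse_injective : Function.Injective (reverse (M := M)) := fun a b h ↦ by
  obtain ⟨ω, rfl⟩ := ofWord_surjective a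
  obtain ⟨ω', rfl⟩ := ofWord_surjective b
  rw [reverse_ofWord, reverse_ofWord, MulOpposite.op_inj] at h
  simpa only [reverse_ofWord, List.reverse_reverse, MulOpposite.op_inj] using congrArg reverse h

end Reverse

end ArtinTitsMonoid

/-- For a Coxeter matrix `M` on a finite index set whose Coxeter group is finite
(spherical type), the Artin–Tits monoid `A⁺(M)` is left- and right-cancellative. -/
theorem artinTitsMonoid_cancellative {B : Type*} [Finite B] (M : CoxeterMatrix B)
    (hW : Finite M.Group) :
    (∀ a b c : ArtinTitsMonoid M, a * b = a * c → b = c) ∧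
    (∀ a b c : ArtinTitsMonoid M, b * a = c * a → b = c) := by
  have left (a b c : ArtinTitsMonoid M) (h : a * b = a * c) : b = c :=
    ArtinTitsMonoid.mul_left_cancel_of_finite M.toCoxeterSystem h
  refine ⟨left, fun a b c h ↦ ArtinTitsMonoid.reverse_injective <| MulOpposite.unop_injective ?_⟩
  have := congrArg (fun x ↦ (ArtinTitsMonoid.reverse x).unop) h
  simp only [map_mul, MulOpposite.unop_mul] at this
  exact left _ _ _ this
end
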